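/- arXiv:2501.03270 — 3 statements merged into one kernel-verified Lean document; each statement's English description precedes it below -/
import Mathlib

section
/- Assume θ > 1 (so that R∞ := ∫₀^∞ r(u) du < ∞), and α/γ = 1 with Q(t) → ∞ as t → ∞. Then for every λ > 0, taking s_λ(t) = exp(−λ/W(μt)), one has (1 − Φ(t; s_λ(t)))/(1 − Φ(t;0)) → λ^α (1 + λ^γ)^{−α/γ} as t → ∞; equivalently, E[exp(−λ Y(t)/W(μt)) | Y(t) > 0] converges to 1 − λ^α (1 + λ^γ)^{−α/γ}. -/
section RegularVariation

open Filter MeasureTheory Set Topology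

/-- `f` is regularly varying at infinity with index `ρ`. -/
def RegularlyVarying (f : ℝ → ℝ) (ρ : ℝ) : Prop :=
  ∀ c > (0 : ℝ), Tendsto (fun t => f (c * t) / f t) atTop (𝓝 (c ^ ρ))

/-- For a monotone regularly varying function the scaling limit holds along asymptotically
proportional arguments. -/
theorem RegularlyVarying.tendsto_div_of_monotoneOn {ι : Type*} {F : Filter ι} {f : ℝ → ℝ}
    {ρ a c : ℝ} {u v : ι → ℝ} (hf : RegularlyVarying f ρ) (hmono : MonotoneOn f (Ici a))
    (hpos : ∀ᶠ x in atTop, 0 < f x) (hu : Tendsto u F atTop)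
    (hvu : Tendsto (fun i => v i / u i) F (𝓝 c)) (hc : 0 < c) :
    Tendsto (fun i => f (v i) / f (u i)) F (𝓝 (c ^ ρ)) := by
  have hcont : ContinuousAt (fun x : ℝ => x ^ ρ) c := Real.continuousAt_rpow_const c ρ (Or.inl hc.ne')
  have hva : ∀ᶠ i in F, a ≤ v i := by
    have hv : Tendsto (fun i => v i / u i * u i) F atTop := hvu.pos_mul_atTop hc hu
    filter_upwards [hv.eventually_ge_atTop a, hu.eventually_gt_atTop 0] with i hi hui
    rwa [div_mul_cancel₀ _ hui.ne'] at hi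
  have hscale : ∀ c' > (0 : ℝ), ∀ᶠ i in F, a ≤ c' * u i := fun c' hc' =>
    (hu.const_mul_atTop hc').eventually_ge_atTop a
  rw [tendsto_order]
  constructor
  · intro b hb
    have h1 : ∀ᶠ x in 𝓝[<] c, b < x ^ ρ ∧ 0 < x :=
      ((hcont.eventually (lt_mem_nhds hb)).and (lt_mem_nhds hc)).filter_mono nhdsWithin_le_nhds
    obtain ⟨c', ⟨h1, h2⟩, h3⟩ := (h1.and self_mem_nhdsWithin).exists
    filter_upwards [((hf c' h2).comp hu).eventually (lt_mem_nhds h1), hva, hscale c' h2,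
      hvu.eventually (lt_mem_nhds h3), hu.eventually hpos, hu.eventually_gt_atTop 0]
      with i hi hv hs hlt hfp hui
    have : c' * u i ≤ v i := ((lt_div_iff₀ hui).1 hlt).le
    exact lt_of_lt_of_le hi (div_le_div_of_nonneg_right (hmono hs hv this) hfp.le)
  · intro b hb
    have h1 : ∀ᶠ x in 𝓝[>] c, x ^ ρ < b :=
      (hcont.eventually (gt_mem_nhds hb)).filter_mono nhdsWithin_le_nhds
    obtain ⟨c', h1, h3⟩ := (h1.and self_mem_nhdsWithin).exists
    have h2 : 0 < c' := hc.trans h3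
    filter_upwards [((hf c' h2).comp hu).eventually (gt_mem_nhds h1), hva, hscale c' h2,
      hvu.eventually (gt_mem_nhds h3), hu.eventually hpos, hu.eventually_gt_atTop 0]
      with i hi hv hs hlt hfp hui
    have : v i ≤ c' * u i := ((div_lt_iff₀ hui).1 hlt).le
    exact lt_of_le_of_lt (div_le_div_of_nonneg_right (hmono hv hs this) hfp.le) hi

theorem RegularlyVarying.comp_mul {f : ℝ → ℝ} {ρ a : ℝ} (hf : RegularlyVarying f ρ) (ha : 0 < a) :
    RegularlyVarying (fun t => f (a * t)) ρ := by
  intro c hc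
  refine ((hf c hc).comp (tendsto_id.const_mul_atTop ha)).congr fun t => ?_
  simp [mul_left_comm]

theorem RegularlyVarying.inv {f : ℝ → ℝ} {ρ : ℝ} (hf : RegularlyVarying f ρ) :
    RegularlyVarying (fun t => (f t)⁻¹) (-ρ) := by
  intro c hc
  rw [Real.rpow_neg hc.le]
  refine ((hf c hc).inv₀ (Real.rpow_pos_of_pos hc ρ).ne').congr fun t => ?_
  simp [div_eq_mul_inv, mul_comm]

/-- A positive regularly varying function of index `ρ`, bounded on dyadic blocks, is `o(t ^ σ)`
for every `σ > ρ`. -/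
theorem RegularlyVarying.tendsto_mul_rpow_zero {f : ℝ → ℝ} {ρ σ : ℝ} (hf : RegularlyVarying f ρ)
    (hpos : ∀ᶠ x in atTop, 0 < f x) (hσ : ρ < σ)
    (hbdd : ∀ᶠ T in atTop, ∃ B, ∀ t ∈ Icc T (2 * T), f t ≤ B) :
    Tendsto (fun t => f t * t ^ (-σ)) atTop (𝓝 0) := by
  obtain ⟨k, hk1, hk2⟩ := exists_between (Real.rpow_lt_rpow_of_exponent_lt one_lt_two hσ)
  have h2σ : (0 : ℝ) < 2 ^ σ := by positivity
  have hk0 : 0 < k := lt_trans (by positivity) hk1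
  set κ := k * (2 : ℝ) ^ (-σ) with hκ
  have hκ1 : κ < 1 := by
    rw [hκ, Real.rpow_neg two_pos.le, ← div_eq_mul_inv, div_lt_one h2σ]; exact hk2
  have hκ0 : 0 < κ := by positivity
  set g := fun t => f t * t ^ (-σ) with hg
  obtain ⟨T0, hT0⟩ := eventually_atTop.1
    (((hf 2 two_pos).eventually (gt_mem_nhds hk1)).and (hpos.and hbdd))
  set T := max T0 1
  have hT1 : 1 ≤ T := le_max_right _ _
  have hT : ∀ t ≥ T, f (2 * t) / f t < k ∧ 0 < f t ∧ ∃ B, ∀ s ∈ Icc t (2 * t), f s ≤ B :=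
    fun t ht => hT0 t ((le_max_left _ _).trans ht)
  have hstep : ∀ t ≥ T, g (2 * t) ≤ κ * g t := by
    intro t ht
    have h := hT t ht
    have ht0 : 0 < t := by linarith
    have h1 : f (2 * t) ≤ k * f t := ((div_lt_iff₀ h.2.1).1 h.1).le
    have : (2 * t) ^ (-σ) = 2 ^ (-σ) * t ^ (-σ) := Real.mul_rpow two_pos.le ht0.le
    simp only [hg, hκ, this]
    calc f (2 * t) * (2 ^ (-σ) * t ^ (-σ)) ≤ k * f t * (2 ^ (-σ) * t ^ (-σ)) := by gcongr
      _ = _ := by ring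
  obtain ⟨B, hB⟩ := (hT T le_rfl).2.2
  have hgpos : ∀ t ≥ T, 0 ≤ g t := fun t ht =>
    mul_nonneg (hT t ht).2.1.le (Real.rpow_nonneg (by linarith) _)
  obtain ⟨A, hA⟩ : ∃ A, ∀ t ∈ Icc T (2 * T), g t ≤ A := by
    have hc : ContinuousOn (fun t : ℝ => t ^ (-σ)) (Icc T (2 * T)) := fun t ht =>
      (Real.continuousAt_rpow_const t _ (Or.inl (by linarith [ht.1]))).continuousWithinAt
    obtain ⟨D, hD⟩ := isCompact_Icc.bddAbove_image hc
    refine ⟨B * D, fun t ht => ?_⟩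
    have h1 : t ^ (-σ) ≤ D := hD ⟨t, ht, rfl⟩
    have h2 := hB t ht
    have h3 := (hT t ht.1).2.1
    have h4 : 0 ≤ t ^ (-σ) := Real.rpow_nonneg (by linarith [ht.1]) _
    exact mul_le_mul h2 h1 h4 (h3.le.trans h2)
  have hA0 : 0 ≤ A := (hgpos T le_rfl).trans (hA T ⟨le_rfl, by linarith⟩)
  have hbound : ∀ n : ℕ, ∀ t ∈ Icc T (2 ^ (n + 1) * T), g t ≤ A := by
    intro n
    induction n with
    | zero => simpa using hA
    | succ n ih =>
      intro t ht
      by_cases h : t ≤ 2 * T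
      · exact hA t ⟨ht.1, h⟩
      · have h1 : T ≤ t / 2 := by linarith
        have h2 : t / 2 ≤ 2 ^ (n + 1) * T := by
          have := ht.2; rw [pow_succ] at this; linarith
        have h3 := hstep (t / 2) h1
        rw [mul_div_cancel₀ t two_ne_zero] at h3
        nlinarith [ih _ ⟨h1, h2⟩, hgpos _ h1]
  have hboundT : ∀ t ≥ T, g t ≤ A := by
    intro t ht
    obtain ⟨n, hn⟩ := pow_unbounded_of_one_lt t one_lt_two
    refine hbound n t ⟨ht, ?_⟩
    have : (2 : ℝ) ^ n ≤ 2 ^ (n + 1) := pow_le_pow_right₀ one_le_two n.le_succ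
    nlinarith [pow_pos (two_pos : (0 : ℝ) < 2) n]
  have hdecay : ∀ n : ℕ, ∀ t ≥ 2 ^ n * T, g t ≤ κ ^ n * A := by
    intro n
    induction n with
    | zero => simpa using hboundT
    | succ n ih =>
      intro t ht
      have h2 : 2 ^ n * T ≤ t / 2 := by rw [pow_succ] at ht; linarith
      have h1 : T ≤ t / 2 := by nlinarith [one_le_pow₀ (one_le_two : (1 : ℝ) ≤ 2) (n := n)]
      have h3 := hstep (t / 2) h1
      rw [mul_div_cancel₀ t two_ne_zero] at h3
      calc g t ≤ κ * g (t / 2) := h3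
        _ ≤ κ * (κ ^ n * A) := by gcongr; exact ih _ h2
        _ = _ := by ring
  rw [tendsto_order]
  refine ⟨fun b hb => ?_, fun b hb => ?_⟩
  · filter_upwards [eventually_ge_atTop T] with t ht using hb.trans_le (hgpos t ht)
  · have hlim : Tendsto (fun n : ℕ => κ ^ n * A) atTop (𝓝 0) := by
      simpa using (tendsto_pow_atTop_nhds_zero_of_lt_one hκ0.le hκ1).mul_const A
    obtain ⟨n, hn⟩ := (hlim.eventually (gt_mem_nhds hb)).exists
    filter_upwards [eventually_ge_atTop (2 ^ n * T)] with t ht using (hdecay n t ht).trans_lt hn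

/-- If `f' ≤ K g'` near infinity and `g → ∞`, then `f / g` is eventually below any `b > K`. -/
theorem eventually_div_lt_of_deriv_le {f g f' g' : ℝ → ℝ} {K b : ℝ}
    (hf : ∀ᶠ x in atTop, HasDerivAt f (f' x) x) (hg : ∀ᶠ x in atTop, HasDerivAt g (g' x) x)
    (hle : ∀ᶠ x in atTop, f' x ≤ K * g' x) (hgtop : Tendsto g atTop atTop) (hb : K < b) :
    ∀ᶠ x in atTop, f x / g x < b := by
  obtain ⟨T, hT⟩ := eventually_atTop.1 (hf.and (hg.and hle))
  have hder : ∀ x ∈ Ici T, HasDerivAt (fun x => f x - K * g x) (f' x - K * g' x) x :=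
    fun x hx => (hT x hx).1.sub ((hT x hx).2.1.const_mul K)
  have hanti : AntitoneOn (fun x => f x - K * g x) (Ici T) := by
    refine antitoneOn_of_deriv_nonpos (convex_Ici T)
      (fun x hx => (hder x hx).continuousAt.continuousWithinAt)
      (fun x hx => (hder x (interior_subset hx)).differentiableAt.differentiableWithinAt)
      fun x hx => ?_
    rw [(hder x (interior_subset hx)).deriv]
    linarith [(hT x (interior_subset hx)).2.2]
  have hlim := hgtop.const_mul_atTop (sub_pos.2 hb)
  filter_upwards [eventually_ge_atTop T, hgtop.eventually_gt_atTop 0,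
    hlim.eventually_gt_atTop (f T - K * g T)] with x hx hgx hlt
  have := hanti self_mem_Ici hx hx
  rw [div_lt_iff₀ hgx]
  simp only at this
  linarith

/-- L'Hôpital's rule at infinity in the case of an infinite denominator. -/
theorem tendsto_div_of_deriv_div_atTop {f g f' g' : ℝ → ℝ} {k : ℝ}
    (hf : ∀ᶠ x in atTop, HasDerivAt f (f' x) x) (hg : ∀ᶠ x in atTop, HasDerivAt g (g' x) x)
    (hg'pos : ∀ᶠ x in atTop, 0 < g' x) (hgtop : Tendsto g atTop atTop)
    (hlim : Tendsto (fun x => f' x / g' x) atTop (𝓝 k)) :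
    Tendsto (fun x => f x / g x) atTop (𝓝 k) := by
  rw [tendsto_order]
  constructor
  · intro b hb
    obtain ⟨K, hK1, hK2⟩ := exists_between hb
    have hle : ∀ᶠ x in atTop, -f' x ≤ -K * g' x := by
      filter_upwards [hlim.eventually (lt_mem_nhds hK2), hg'pos] with x hx hp
      linarith [(lt_div_iff₀ hp).1 hx]
    have := eventually_div_lt_of_deriv_le (hf.mono fun x hx => hx.neg) hg hle hgtop
      (neg_lt_neg hK1)
    filter_upwards [this] with x hx
    simp only [Pi.neg_apply, neg_div] at hx
    linarith
  · intro b hb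
    obtain ⟨K, hK1, hK2⟩ := exists_between hb
    refine eventually_div_lt_of_deriv_le hf hg ?_ hgtop hK2
    filter_upwards [hlim.eventually (gt_mem_nhds hK1), hg'pos] with x hx hp
    exact ((div_lt_iff₀ hp).1 hx).le

/-- Direct half of Karamata's theorem: if the primitive of a positive regularly varying function
diverges, then it is regularly varying, with the index raised by one. -/
theorem RegularlyVarying.of_hasDerivAt {G g : ℝ → ℝ} {ρ : ℝ}
    (hder : ∀ᶠ x in atTop, HasDerivAt G (g x) x) (hpos : ∀ᶠ x in atTop, 0 < g x)
    (hGtop : Tendsto G atTop atTop) (hg : RegularlyVarying g (ρ - 1)) :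
    RegularlyVarying G ρ := by
  intro c hc
  have hcder : ∀ᶠ x in atTop, HasDerivAt (fun x => G (c * x)) (g (c * x) * c) x := by
    filter_upwards [(tendsto_id.const_mul_atTop hc).eventually hder] with x hx
    exact HasDerivAt.comp x hx (by simpa using (hasDerivAt_id x).const_mul c)
  refine tendsto_div_of_deriv_div_atTop hcder hder hpos hGtop ?_
  have h := (hg c hc).mul_const c
  rw [Real.rpow_sub_one hc.ne', div_mul_cancel₀ _ hc.ne'] at h
  exact h.congr fun t => by ring

/-- The inverse of a monotone regularly varying function of positive index is regularly varying. -/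
theorem RegularlyVarying.of_inverse {V W : ℝ → ℝ} {γ a : ℝ} (hV : RegularlyVarying V γ)
    (hγ : 0 < γ) (hmono : MonotoneOn V (Ici a))
    (hWmem : ∀ y ∈ Ici (0 : ℝ), W y ∈ Ici a) (hVW : ∀ y ∈ Ici (0 : ℝ), V (W y) = y)
    (hWtop : Tendsto W atTop atTop) : RegularlyVarying W (1 / γ) := by
  intro c hc
  have hkey : ∀ b : ℝ, 0 < b → Tendsto (fun t => V (b * W t) / t) atTop (𝓝 (b ^ γ)) := by
    intro b hb
    refine ((hV b hb).comp hWtop).congr' ?_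
    filter_upwards [eventually_ge_atTop 0] with t ht
    simp [hVW t ht]
  have hcpow : (c ^ (1 / γ)) ^ γ = c := by
    rw [← Real.rpow_mul hc.le, one_div, inv_mul_cancel₀ hγ.ne', Real.rpow_one]
  have hc0 : 0 < c ^ (1 / γ) := by positivity
  rw [tendsto_order]
  constructor
  · intro b hb
    obtain ⟨b', hb1, hb2⟩ := exists_between (max_lt hb hc0)
    have hb'0 : 0 < b' := (le_max_right _ _).trans_lt hb1
    have hlt : b' ^ γ < c := by rw [← hcpow]; exact Real.rpow_lt_rpow hb'0.le hb2 hγ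
    filter_upwards [(hkey b' hb'0).eventually (gt_mem_nhds hlt), eventually_gt_atTop 0,
      hWtop.eventually_gt_atTop 0, (hWtop.const_mul_atTop hb'0).eventually_ge_atTop a]
      with t h1 ht hW hWa
    rw [div_lt_iff₀ ht] at h1
    rw [lt_div_iff₀ hW]
    refine (mul_lt_mul_of_pos_right ((le_max_left _ _).trans_lt hb1) hW).trans_le ?_
    by_contra! h
    have hct : 0 ≤ c * t := by positivity
    have := hmono (hWmem _ hct) hWa h.le
    rw [hVW _ hct] at this
    linarith
  · intro b hb
    have hb0 : 0 < b := hc0.trans hb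
    have hlt : c < b ^ γ := by
      conv_lhs => rw [← hcpow]
      exact Real.rpow_lt_rpow hc0.le hb hγ
    filter_upwards [(hkey b hb0).eventually (lt_mem_nhds hlt), eventually_gt_atTop 0,
      hWtop.eventually_gt_atTop 0, (hWtop.const_mul_atTop hb0).eventually_ge_atTop a]
      with t h1 ht hW hWa
    rw [lt_div_iff₀ ht] at h1
    rw [div_lt_iff₀ hW]
    by_contra! h
    have hct : 0 ≤ c * t := by positivity
    have := hmono hWa (hWmem _ hct) h
    rw [hVW _ hct] at this
    linarith

end RegularVariation

section Convolution

open Filter MeasureTheory Set Topology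

theorem tendsto_intervalIntegral_mul_of_bounded {r b : ℝ → ℝ} {F : ℝ → ℝ → ℝ} {C k : ℝ}
    (hr : IntegrableOn r (Ioi 0)) (hb : Tendsto b atTop atTop)
    (hmeas : ∀ᶠ t in atTop, AEStronglyMeasurable (F t) (volume.restrict (Ioc 0 (b t))))
    (hbdd : ∀ᶠ t in atTop, ∀ v ∈ Ioc 0 (b t), |F t v| ≤ C)
    (hlim : ∀ v > (0 : ℝ), Tendsto (fun t => F t v) atTop (𝓝 k)) :
    Tendsto (fun t => ∫ v in (0 : ℝ)..b t, r v * F t v) atTop (𝓝 ((∫ v in Ioi 0, r v) * k)) := by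
  have hC : 0 ≤ C := by
    obtain ⟨t, h1, h2⟩ := (hbdd.and (hb.eventually_gt_atTop 0)).exists
    exact (abs_nonneg _).trans (h1 (b t) ⟨h2, le_rfl⟩)
  have hkey : Tendsto (fun t => ∫ v in Ioi (0 : ℝ), (Ioc 0 (b t)).indicator (fun v => r v * F t v) v)
      atTop (𝓝 (∫ v in Ioi 0, r v * k)) := by
    refine tendsto_integral_filter_of_dominated_convergence (fun v => |r v| * C) ?_ ?_
      (hr.abs.mul_const C) ?_
    · filter_upwards [hmeas] with t ht
      rw [aestronglyMeasurable_indicator_iff measurableSet_Ioc,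
        Measure.restrict_restrict measurableSet_Ioc, inter_eq_left.2 fun v hv => hv.1]
      exact (hr.mono_set fun v hv => hv.1).aestronglyMeasurable.mul ht
    · filter_upwards [hbdd] with t ht
      refine ae_of_all _ fun v => ?_
      by_cases hv : v ∈ Ioc 0 (b t)
      · rw [indicator_of_mem hv, Real.norm_eq_abs, abs_mul]
        gcongr
        exact ht v hv
      · rw [indicator_of_notMem hv, norm_zero]
        positivity
    · refine (ae_restrict_mem measurableSet_Ioi).mono fun v hv => ?_
      refine ((hlim v hv).const_mul (r v)).congr' ?_
      filter_upwards [hb.eventually_ge_atTop v] with t ht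
      rw [indicator_of_mem (show v ∈ Ioc 0 (b t) from ⟨hv, ht⟩)]
  rw [integral_mul_const] at hkey
  refine hkey.congr' ?_
  filter_upwards [hb.eventually_ge_atTop 0] with t ht
  rw [setIntegral_indicator measurableSet_Ioc, inter_eq_right.2 fun v hv => hv.1,
    intervalIntegral.integral_of_le ht]

theorem intervalIntegral_convolution_eq (r : ℝ → ℝ) (K : ℝ → ℝ) (t p : ℝ) :
    K t * ∫ u in (0 : ℝ)..t, r (t - u) * (K (u + p))⁻¹ =
      ∫ v in (0 : ℝ)..t, r v * (K t / K (t - v + p)) := by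
  rw [← intervalIntegral.integral_const_mul]
  have h := intervalIntegral.integral_comp_sub_left (a := 0) (b := t)
    (fun v => r v * (K t / K (t - v + p))) t
  rw [sub_self, sub_zero] at h
  rw [← h]
  refine intervalIntegral.integral_congr fun u _ => ?_
  simp only [sub_sub_cancel]
  ring

theorem aestronglyMeasurable_div_of_monotoneOn {K : ℝ → ℝ} (hmono : MonotoneOn K (Ici 0))
    {t p b : ℝ} (ht : 0 < K t) (hw0 : 0 ≤ t - b + p) (hw : 0 < K (t - b + p)) :
    AEStronglyMeasurable (fun v => K t / K (t - v + p)) (volume.restrict (Ioc 0 b)) := by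
  refine (aemeasurable_restrict_of_monotoneOn measurableSet_Ioc ?_).aestronglyMeasurable
  intro v hv v' hv' hvv
  have h1 : 0 ≤ t - v' + p := by linarith [hv'.2]
  have h2 : K (t - b + p) ≤ K (t - v' + p) := hmono hw0 h1 (by linarith [hv'.2])
  exact div_le_div_of_nonneg_left ht.le (hw.trans_le h2)
    (hmono h1 (by simp only [mem_Ici]; linarith) (by linarith))

/-- The part of the convolution on which the argument of `K` stays comparable with `t`. -/
theorem RegularlyVarying.tendsto_integral_mul_div {r K b p : ℝ → ℝ} {c d : ℝ}
    (hr : IntegrableOn r (Ioi 0)) (hK : RegularlyVarying K 1) (hmono : MonotoneOn K (Ici 0))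
    (hKtop : Tendsto K atTop atTop) (hb : Tendsto b atTop atTop) (hc : 0 ≤ c) (hd : 0 < d)
    (hp : Tendsto (fun t => p t / t) atTop (𝓝 c))
    (hw : Tendsto (fun t => (t - b t + p t) / t) atTop (𝓝 d)) :
    Tendsto (fun t => ∫ v in (0 : ℝ)..b t, r v * (K t / K (t - v + p t))) atTop
        (𝓝 ((∫ v in Ioi 0, r v) * (1 + c)⁻¹)) ∧
      ∀ᶠ t in atTop,
        IntervalIntegrable (fun v => r v * (K t / K (t - v + p t))) volume 0 (b t) := by
  have hKpos := hKtop.eventually_gt_atTop 0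
  have hratio := hK.tendsto_div_of_monotoneOn hmono hKpos tendsto_id hw hd
  rw [Real.rpow_one] at hratio
  have hbound := (hratio.inv₀ hd.ne').eventually (gt_mem_nhds (lt_add_one d⁻¹))
  have hwtop : Tendsto (fun t => t - b t + p t) atTop atTop := by
    refine (hw.pos_mul_atTop hd tendsto_id).congr' ?_
    filter_upwards [eventually_ne_atTop 0] with t ht
    simp [div_mul_cancel₀ _ ht]
  have hgood : ∀ᶠ t in atTop,
      AEStronglyMeasurable (fun v => K t / K (t - v + p t)) (volume.restrict (Ioc 0 (b t))) ∧
      ∀ v ∈ Ioc 0 (b t), |K t / K (t - v + p t)| ≤ d⁻¹ + 1 := by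
    filter_upwards [hbound, hKpos, hwtop.eventually hKpos, hwtop.eventually_ge_atTop 0]
      with t h1 h2 h3 h4
    refine ⟨aestronglyMeasurable_div_of_monotoneOn hmono h2 h4 h3, fun v hv => ?_⟩
    have h5 : K (t - b t + p t) ≤ K (t - v + p t) :=
      hmono h4 (by simp only [mem_Ici]; linarith [hv.2]) (by linarith [hv.2])
    rw [abs_of_nonneg (div_nonneg h2.le (h3.le.trans h5))]
    refine (div_le_div_of_nonneg_left h2.le h3 h5).trans ?_
    simpa using h1.le
  refine ⟨tendsto_intervalIntegral_mul_of_bounded hr hb (hgood.mono fun t h => h.1)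
    (hgood.mono fun t h => h.2) fun v _ => ?_, ?_⟩
  · have harg : Tendsto (fun t => (t - v + p t) / t) atTop (𝓝 (1 + c)) := by
      have h1 : Tendsto (fun t : ℝ => 1 - v / t + p t / t) atTop (𝓝 (1 - 0 + c)) :=
        (tendsto_const_nhds.sub (tendsto_id.const_div_atTop v)).add hp
      rw [sub_zero] at h1
      refine h1.congr' ?_
      filter_upwards [eventually_ne_atTop 0] with t ht
      field_simp
    have h := hK.tendsto_div_of_monotoneOn hmono hKpos tendsto_id harg (by positivity)
    rw [Real.rpow_one] at h
    simpa using h.inv₀ (by positivity)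
  · filter_upwards [hgood, hb.eventually_ge_atTop 0] with t ht hbt
    rw [intervalIntegrable_iff_integrableOn_Ioc_of_le hbt]
    refine Integrable.mul_bdd (c := d⁻¹ + 1) (hr.mono_set fun v hv => hv.1) ht.1 ?_
    exact (ae_restrict_mem measurableSet_Ioc).mono fun v hv => ht.2 v hv

/-- The primitive of the reciprocal of a function of index one grows slower than any power. -/
theorem RegularlyVarying.eventually_integral_abs_inv_le {K : ℝ → ℝ} {δ : ℝ}
    (hK : RegularlyVarying K 1) (hmono : MonotoneOn K (Ici 0)) (hKtop : Tendsto K atTop atTop)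
    (hinteg : ∀ t > (0 : ℝ), IntervalIntegrable (fun u => (K u)⁻¹) volume 0 t) (hδ : 0 < δ) :
    ∀ᶠ t in atTop, ∫ u in (0 : ℝ)..t, |(K u)⁻¹| ≤ (1 + δ⁻¹) * t ^ δ := by
  have hKpos := hKtop.eventually_gt_atTop 0
  have hsmall := hK.inv.tendsto_mul_rpow_zero (σ := -1 + δ) (hKpos.mono fun x hx => inv_pos.2 hx)
    (by linarith) <| by
      filter_upwards [hKpos, eventually_ge_atTop 0] with T hT hT0
      exact ⟨(K T)⁻¹, fun t ht => inv_anti₀ hT (hmono hT0 (hT0.trans ht.1) ht.1)⟩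
  obtain ⟨T, hT⟩ := eventually_atTop.1 ((hsmall.eventually (gt_mem_nhds one_pos)).and
    (hKpos.and (eventually_gt_atTop 0)))
  have hT0 := (hT T le_rfl).2.2
  filter_upwards [eventually_ge_atTop T, (tendsto_rpow_atTop hδ).eventually_ge_atTop
    (∫ u in (0 : ℝ)..T, |(K u)⁻¹|)] with t ht htT
  have ht0 : 0 < t := hT0.trans_le ht
  have hintT := (hinteg T hT0).abs
  have hintt : IntervalIntegrable (fun u => |(K u)⁻¹|) volume T t := hintT.symm.trans (hinteg t ht0).abs
  have hpow : IntervalIntegrable (fun u : ℝ => u ^ (δ - 1)) volume T t :=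
    intervalIntegral.intervalIntegrable_rpow' (by linarith)
  have hle : ∫ u in T..t, |(K u)⁻¹| ≤ ∫ u in T..t, u ^ (δ - 1) := by
    refine intervalIntegral.integral_mono_on ht hintt hpow fun u hu => ?_
    have h := hT u hu.1
    have hu0 : 0 < u := h.2.2
    rw [abs_of_pos (inv_pos.2 h.2.1)]
    have h1 := h.1
    rw [Real.rpow_neg hu0.le, ← div_eq_mul_inv, div_lt_one (by positivity)] at h1
    rw [sub_eq_neg_add]
    exact h1.le
  rw [integral_rpow (Or.inl (by linarith)), sub_add_cancel] at hle
  rw [← intervalIntegral.integral_add_adjacent_intervals hintT hintt, add_mul, one_mul]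
  refine add_le_add htT (hle.trans ?_)
  rw [div_eq_inv_mul]
  have : 0 ≤ T ^ δ := by positivity
  gcongr
  linarith

theorem RegularlyVarying.tendsto_mul_integral_abs_inv_zero {r K : ℝ → ℝ} {θ : ℝ} (hθ : 1 < θ)
    (hrpos : ∀ t > (0 : ℝ), 0 < r t) (hranti : AntitoneOn r (Ioi 0))
    (hr : RegularlyVarying r (-θ)) (hK : RegularlyVarying K 1) (hmono : MonotoneOn K (Ici 0))
    (hKtop : Tendsto K atTop atTop)
    (hinteg : ∀ t > (0 : ℝ), IntervalIntegrable (fun u => (K u)⁻¹) volume 0 t) :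
    Tendsto (fun t => r t * (∫ u in (0 : ℝ)..t, |(K u)⁻¹|) * K t) atTop (𝓝 0) := by
  set δ := (θ - 1) / 4 with hδdef
  have hδ : 0 < δ := by simp only [hδdef]; linarith
  have hKpos := hKtop.eventually_gt_atTop 0
  have hr0 := hr.tendsto_mul_rpow_zero (σ := -1 - 2 * δ)
    ((eventually_gt_atTop 0).mono fun x hx => hrpos x hx) (by linarith) <| by
      filter_upwards [eventually_gt_atTop 0] with T hT
      exact ⟨r T, fun t ht => hranti hT (hT.trans_le ht.1) ht.1⟩
  have hK0 := hK.tendsto_mul_rpow_zero (σ := 1 + δ) hKpos (by linarith) <| by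
      filter_upwards [eventually_ge_atTop 0] with T hT
      exact ⟨K (2 * T), fun t ht => hmono (hT.trans ht.1)
        (by simp only [mem_Ici]; linarith) ht.2⟩
  have hm := hK.eventually_integral_abs_inv_le hmono hKtop hinteg hδ
  have hprod := (hr0.mul hK0).const_mul (1 + δ⁻¹)
  rw [mul_zero, mul_zero] at hprod
  refine squeeze_zero' ?_ ?_ hprod
  · filter_upwards [eventually_gt_atTop 0, hKpos] with t ht hKt
    exact mul_nonneg (mul_nonneg (hrpos t ht).le
      (intervalIntegral.integral_nonneg ht.le fun u _ => abs_nonneg _)) hKt.le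
  · filter_upwards [eventually_gt_atTop 0, hKpos, hm] with t ht hKt hmt
    have hrt := hrpos t ht
    calc r t * (∫ u in (0 : ℝ)..t, |(K u)⁻¹|) * K t
        ≤ r t * ((1 + δ⁻¹) * t ^ δ) * K t := by gcongr
      _ = (1 + δ⁻¹) * (r t * t ^ (-(-1 - 2 * δ)) * (K t * t ^ (-(1 + δ)))) := by
        have h : t ^ δ = t ^ (-(-1 - 2 * δ)) * t ^ (-(1 + δ)) := by
          rw [← Real.rpow_add ht]; congr 1; ring
        rw [h]; ring

/-- For an integrable kernel of index `-θ`, `θ > 1`, the convolution with `1 / K`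
is asymptotic to `(∫ r) / K`. -/
theorem RegularlyVarying.tendsto_mul_convolution {r K : ℝ → ℝ} {θ : ℝ} (hθ : 1 < θ)
    (hrpos : ∀ t > (0 : ℝ), 0 < r t) (hranti : AntitoneOn r (Ioi 0))
    (hrint : IntegrableOn r (Ioi 0))
    (hr : RegularlyVarying r (-θ)) (hK : RegularlyVarying K 1) (hmono : MonotoneOn K (Ici 0))
    (hKtop : Tendsto K atTop atTop)
    (hinteg : ∀ t > (0 : ℝ), IntervalIntegrable (fun u => (K u)⁻¹) volume 0 t) :
    Tendsto (fun t => K t * ∫ u in (0 : ℝ)..t, r (t - u) * (K u)⁻¹) atTop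
      (𝓝 (∫ v in Ioi 0, r v)) := by
  have hhalf : Tendsto (fun t : ℝ => t / 2) atTop atTop := tendsto_id.atTop_div_const two_pos
  have hKpos := hKtop.eventually_gt_atTop 0
  obtain ⟨hmain, hmain_int⟩ := hK.tendsto_integral_mul_div (p := fun _ => 0) (c := 0) (d := 1 / 2)
    hrint hmono hKtop hhalf le_rfl (by norm_num) (by simp) <| by
      refine tendsto_const_nhds.congr' ?_
      filter_upwards [eventually_ne_atTop 0] with t ht
      field_simp
      norm_num
  simp only [add_zero, inv_one, mul_one] at hmain hmain_int
  have herr : Tendsto (fun t => r (t / 2) * (∫ u in (0 : ℝ)..t / 2, |(K u)⁻¹|) * K t) atTop (𝓝 0) := by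
    have h1 := (hr.tendsto_mul_integral_abs_inv_zero hθ hrpos hranti hK hmono hKtop hinteg).comp hhalf
    have h2 := (hK 2 two_pos).comp hhalf
    have h3 := h1.mul h2
    rw [zero_mul] at h3
    refine h3.congr' ?_
    filter_upwards [hhalf.eventually hKpos] with t ht
    simp only [Function.comp_apply, mul_div_cancel₀ t (two_ne_zero' ℝ)]
    field_simp
  have htail : ∀ᶠ t in atTop,
      IntervalIntegrable (fun v => r v * (K t / K (t - v))) volume (t / 2) t ∧
      |∫ v in t / 2..t, r v * (K t / K (t - v))| ≤
        r (t / 2) * (∫ u in (0 : ℝ)..t / 2, |(K u)⁻¹|) * K t := by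
    filter_upwards [eventually_gt_atTop 0, hKpos] with t ht hKt
    have ht2 : 0 < t / 2 := by linarith
    have hle : t / 2 ≤ t := by linarith
    have hflip : IntervalIntegrable (fun v => (K (t - v))⁻¹) volume (t / 2) t := by
      have h := (hinteg (t / 2) ht2).comp_sub_left t
      rw [sub_zero, sub_half] at h
      exact h.symm
    have hdom : IntervalIntegrable (fun v => r (t / 2) * K t * |(K (t - v))⁻¹|) volume (t / 2) t :=
      hflip.abs.const_mul _
    have hptw : ∀ v ∈ Ioc (t / 2) t,
        ‖r v * (K t / K (t - v))‖ ≤ r (t / 2) * K t * |(K (t - v))⁻¹| := by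
      intro v hv
      have hv0 : 0 < v := ht2.trans hv.1
      have hrv : r v ≤ r (t / 2) := hranti ht2 hv0 hv.1.le
      rw [Real.norm_eq_abs, div_eq_mul_inv, abs_mul, abs_mul, abs_of_pos hKt,
        abs_of_pos (hrpos v hv0), mul_assoc]
      gcongr
    constructor
    · refine hdom.mono_fun ?_ ?_
      · rw [uIoc_of_le hle]
        refine (hrint.mono_set fun v hv => ht2.trans hv.1).aestronglyMeasurable.mul ?_
        have h := ((intervalIntegrable_iff_integrableOn_Ioc_of_le hle).1 hflip).aestronglyMeasurable
        exact h.const_mul (K t)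
      · rw [uIoc_of_le hle]
        refine (ae_restrict_mem measurableSet_Ioc).mono fun v hv => ?_
        exact (hptw v hv).trans (le_abs_self _)
    · refine (intervalIntegral.norm_integral_le_of_norm_le hle
        (ae_of_all _ fun v hv => hptw v hv) hdom).trans_eq ?_
      rw [intervalIntegral.integral_const_mul,
        intervalIntegral.integral_comp_sub_left (fun u => |(K u)⁻¹|) t, sub_self, sub_half]
      ring
  have htail0 : Tendsto (fun t => ∫ v in t / 2..t, r v * (K t / K (t - v))) atTop (𝓝 0) :=
    squeeze_zero_norm' (htail.mono fun t h => h.2) herr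
  have hsum := hmain.add htail0
  rw [add_zero] at hsum
  refine hsum.congr' ?_
  filter_upwards [hmain_int, htail] with t h1 h2
  rw [intervalIntegral.integral_add_adjacent_intervals h1 h2.1]
  simpa using (intervalIntegral_convolution_eq r K t 0).symm

theorem RegularlyVarying.tendsto_mul_convolution_shift {r K p : ℝ → ℝ} {c : ℝ}
    (hrint : IntegrableOn r (Ioi 0)) (hK : RegularlyVarying K 1) (hmono : MonotoneOn K (Ici 0))
    (hKtop : Tendsto K atTop atTop) (hc : 0 < c)
    (hp : Tendsto (fun t => p t / t) atTop (𝓝 c)) :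
    Tendsto (fun t => K t * ∫ u in (0 : ℝ)..t, r (t - u) * (K (u + p t))⁻¹) atTop
      (𝓝 ((∫ v in Ioi 0, r v) * (1 + c)⁻¹)) := by
  simp only [intervalIntegral_convolution_eq]
  exact (hK.tendsto_integral_mul_div hrint hmono hKtop tendsto_id hc.le hc hp (by simpa using hp)).1

theorem tendsto_mul_one_sub_exp_neg {ι : Type*} {F : Filter ι} {K a : ι → ℝ} {A : ℝ}
    (hK : Tendsto K F atTop) (ha : Tendsto (fun i => K i * a i) F (𝓝 A)) :
    Tendsto (fun i => K i * (1 - Real.exp (-a i))) F (𝓝 A) := by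
  have ha0 : Tendsto a F (𝓝 0) := by
    have h := hK.inv_tendsto_atTop.mul ha
    rw [zero_mul] at h
    refine h.congr' ?_
    filter_upwards [hK.eventually_gt_atTop 0] with i hi
    simp [inv_mul_cancel_left₀ hi.ne']
  have herr : Tendsto (fun i => K i * (1 - Real.exp (-a i)) - K i * a i) F (𝓝 0) := by
    have h : Tendsto (fun i => |K i * a i| * |a i|) F (𝓝 0) := by
      simpa using ha.abs.mul ha0.abs
    refine squeeze_zero_norm' ?_ h
    have hsmall : ∀ᶠ i in F, |a i| < 1 := by
      have := ha0.abs
      rw [abs_zero] at this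
      exact this.eventually (gt_mem_nhds one_pos)
    filter_upwards [hsmall] with i hi
    have h1 := Real.abs_exp_sub_one_sub_id_le (x := -a i) (by rw [abs_neg]; exact hi.le)
    rw [Real.norm_eq_abs, ← mul_sub, abs_mul, abs_mul, mul_assoc]
    gcongr
    rw [← abs_mul, ← sq, abs_of_nonneg (sq_nonneg (a i)), ← abs_neg]
    rw [neg_sq] at h1
    have h2 : -(1 - Real.exp (-a i) - a i) = Real.exp (-a i) - 1 - -a i := by ring
    rwa [h2]
  simpa using herr.add ha

end Convolution

section SlowVariation

open Filter MeasureTheory Set Topology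

theorem RegularlyVarying.rpow_div {l : ℝ → ℝ} (ρ : ℝ)
    (hl : ∀ c > (0 : ℝ), Tendsto (fun t => l (c * t) / l t) atTop (𝓝 1)) :
    RegularlyVarying (fun x => x ^ ρ / l x) ρ := by
  intro c hc
  have h := ((hl c hc).inv₀ one_ne_zero).const_mul (c ^ ρ)
  rw [inv_one, mul_one] at h
  refine h.congr' ?_
  filter_upwards [eventually_gt_atTop 0] with t ht
  have htρ : t ^ ρ ≠ 0 := (Real.rpow_pos_of_pos ht ρ).ne'
  rw [Real.mul_rpow hc.le ht.le, inv_div, div_div_div_eq, mul_comm (l (c * t)),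
    mul_right_comm, mul_comm (c ^ ρ) (l t), mul_comm (l t * c ^ ρ), mul_div_mul_left _ _ htρ,
    mul_comm (l t), mul_div_assoc]

theorem hasDerivAt_of_eq_integral {V g : ℝ → ℝ} {a x : ℝ} (hg : ContinuousOn g (Ici a))
    (hV : ∀ y ∈ Ici a, V y = ∫ u in a..y, g u) (hx : a < x) : HasDerivAt V (g x) x := by
  have hinteg : IntervalIntegrable g volume a x := by
    refine ContinuousOn.intervalIntegrable (hg.mono ?_)
    rw [uIcc_of_le hx.le]
    exact Icc_subset_Ici_self
  have hmeas : StronglyMeasurableAtFilter g (𝓝 x) volume :=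
    (hg.mono Ioi_subset_Ici_self).stronglyMeasurableAtFilter isOpen_Ioi x hx
  refine (intervalIntegral.integral_hasDerivAt_right hinteg hmeas
    (hg.continuousAt (Ici_mem_nhds hx))).congr_of_eventuallyEq ?_
  filter_upwards [Ici_mem_nhds hx] with y hy using hV y hy

theorem monotoneOn_of_eq_integral {V g : ℝ → ℝ} {a : ℝ} (hg : ContinuousOn g (Ici a))
    (hpos : ∀ u ∈ Ici a, 0 < g u) (hV : ∀ y ∈ Ici a, V y = ∫ u in a..y, g u) :
    MonotoneOn V (Ici a) := by
  intro x hx y hy hxy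
  have hinteg : ∀ z ∈ Ici a, ∀ w ∈ Ici a, IntervalIntegrable g volume z w := fun z hz w hw =>
    ContinuousOn.intervalIntegrable (hg.mono fun u hu => (le_inf hz hw).trans hu.1)
  rw [hV x hx, hV y hy, ← intervalIntegral.integral_add_adjacent_intervals
    (hinteg a self_mem_Ici x hx) (hinteg x hx y hy), le_add_iff_nonneg_right]
  exact intervalIntegral.integral_nonneg hxy fun u hu => (hpos u (le_trans hx hu.1)).le

end SlowVariation


open Filter MeasureTheory Real in
theorem stmt14
    (μ γ α : ℝ) (hμ : 0 < μ) (hγ : γ ∈ Set.Ioc (0:ℝ) 1) (hα : α ∈ Set.Ioc (0:ℝ) 1)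
    (L l : ℝ → ℝ)
    (hLpos : ∀ x ∈ Set.Ici (1:ℝ), 0 < L x)
    (hLcont : ContinuousOn L (Set.Ici 1))
    (hLsv : ∀ c > (0:ℝ), Filter.Tendsto (fun t => L (c * t) / L t) Filter.atTop (nhds 1))
    (hlsv : ∀ c > (0:ℝ), Filter.Tendsto (fun t => l (c * t) / l t) Filter.atTop (nhds 1))
    (V W : ℝ → ℝ)
    (hV : ∀ x ∈ Set.Ici (1:ℝ), V x = ∫ u in (1:ℝ)..x, u ^ (γ - 1) / L u)
    (hVtop : Filter.Tendsto V Filter.atTop Filter.atTop)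
    (hWmem : ∀ y ∈ Set.Ici (0:ℝ), W y ∈ Set.Ici (1:ℝ))
    (hVW : ∀ y ∈ Set.Ici (0:ℝ), V (W y) = y)
    (hWV : ∀ x ∈ Set.Ici (1:ℝ), W (V x) = x)
    (Ψ : ℝ → ℝ)
    (hΨ : ∀ x ∈ Set.Ici (1:ℝ), Ψ x = x ^ α / l x)
    (hΨmono : MonotoneOn Ψ (Set.Ici 1))
    (hΨtop : Filter.Tendsto Ψ Filter.atTop Filter.atTop)
    (q : ℝ → ℝ → ℝ)
    (hq : ∀ t ∈ Set.Ici (0:ℝ), ∀ s ∈ Set.Ico (0:ℝ) 1,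
      q t s = 1 / Ψ (W (μ * t + V (1 / (1 - s)))))
    (θ : ℝ) (hθpos : 0 < θ)
    (r : ℝ → ℝ)
    (hrpos : ∀ t > (0:ℝ), 0 < r t)
    (hranti : AntitoneOn r (Set.Ioi 0))
    (hrint : ∀ t > (0:ℝ), MeasureTheory.IntegrableOn r (Set.Ioc 0 t))
    (hrrv : ∀ c > (0:ℝ), Filter.Tendsto (fun t => r (c * t) / r t) Filter.atTop (nhds (c ^ (-θ))))
    (R Q : ℝ → ℝ)
    (hR : ∀ t, R t = ∫ u in (0:ℝ)..t, r u)
    (hQ : ∀ t, Q t = ∫ u in (0:ℝ)..t, q u 0)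
    (I : ℝ → ℝ → ℝ) (hI : ∀ t s, I t s = ∫ u in (0:ℝ)..t, r (t - u) * q u s)
    (Φ : ℝ → ℝ → ℝ) (hΦ : ∀ t s, Φ t s = Real.exp (-(I t s)))
    (hθ : 1 < θ) (hRfin : MeasureTheory.IntegrableOn r (Set.Ioi 0))
    (hαγ : α / γ = 1) (hQtop : Filter.Tendsto Q Filter.atTop Filter.atTop)
    (lam : ℝ) (hlam : 0 < lam) :
    Filter.Tendsto
      (fun t => (1 - Φ t (Real.exp (-(lam / W (μ * t))))) / (1 - Φ t 0))
      Filter.atTop (nhds (lam ^ α * (1 + lam ^ γ) ^ (-(α / γ)))) := by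
  have hγ0 : 0 < γ := hγ.1
  have hαγ' : α = γ := by rwa [div_eq_one_iff_eq hγ0.ne'] at hαγ
  have hcont : ContinuousOn (fun u => u ^ (γ - 1) / L u) (Set.Ici 1) :=
    (continuousOn_id.rpow_const fun x hx => Or.inl (zero_lt_one.trans_le hx).ne').div hLcont
      fun x hx => (hLpos x hx).ne'
  have hgpos : ∀ u ∈ Set.Ici (1 : ℝ), 0 < u ^ (γ - 1) / L u := fun u hu =>
    div_pos (Real.rpow_pos_of_pos (zero_lt_one.trans_le hu) _) (hLpos u hu)
  have hVmono : MonotoneOn V (Set.Ici 1) := monotoneOn_of_eq_integral hcont hgpos hV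
  have hVrv : RegularlyVarying V γ := by
    refine .of_hasDerivAt (g := fun u => u ^ (γ - 1) / L u) ?_ ?_ hVtop ?_
    · filter_upwards [eventually_gt_atTop 1] with x hx using hasDerivAt_of_eq_integral hcont hV hx
    · filter_upwards [eventually_ge_atTop 1] with x hx using hgpos x hx
    · exact .rpow_div _ hLsv
  have hWmono : MonotoneOn W (Set.Ici 0) := by
    intro y hy y' hy' hle
    by_contra! h
    have h1 := hVmono (hWmem _ hy') (hWmem _ hy) h.le
    rw [hVW _ hy, hVW _ hy'] at h1
    rw [le_antisymm hle h1] at h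
    exact h.false
  have hWtop : Tendsto W atTop atTop := by
    refine tendsto_atTop.2 fun M => ?_
    filter_upwards [eventually_gt_atTop (V (max M 1)), eventually_ge_atTop 0] with y hy hy0
    by_contra! h
    have h1 := hVmono (hWmem y hy0) (Set.mem_Ici.2 (le_max_right M 1))
      (h.le.trans (le_max_left _ _))
    rw [hVW y hy0] at h1
    linarith
  have hWrv : RegularlyVarying W (1 / γ) := hVrv.of_inverse hγ0 hVmono hWmem hVW hWtop
  have hΨrv : RegularlyVarying Ψ α := by
    intro c hc
    refine (RegularlyVarying.rpow_div α hlsv c hc).congr' ?_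
    filter_upwards [eventually_ge_atTop 1, (tendsto_id.const_mul_atTop hc).eventually_ge_atTop 1]
      with t ht hct
    rw [hΨ t ht, hΨ (c * t) hct]
  have hHmono : MonotoneOn (fun y => Ψ (W y)) (Set.Ici 0) := fun y hy y' hy' h =>
    hΨmono (hWmem y hy) (hWmem y' hy') (hWmono hy hy' h)
  have hHrv : RegularlyVarying (fun y => Ψ (W y)) 1 := by
    intro c hc
    have h := hΨrv.tendsto_div_of_monotoneOn hΨmono (hΨtop.eventually_gt_atTop 0) hWtop
      (hWrv c hc) (Real.rpow_pos_of_pos hc _)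
    rwa [← Real.rpow_mul hc.le, hαγ', one_div, inv_mul_cancel₀ hγ0.ne'] at h
  set K : ℝ → ℝ := fun t => Ψ (W (μ * t)) with hKdef
  have hμt : Tendsto (fun t => μ * t) atTop atTop := tendsto_id.const_mul_atTop hμ
  have hKrv : RegularlyVarying K 1 := hHrv.comp_mul hμ
  have hKtop : Tendsto K atTop atTop := hΨtop.comp (hWtop.comp hμt)
  have hKmono : MonotoneOn K (Set.Ici 0) := fun y hy y' hy' h =>
    hHmono (mul_nonneg hμ.le hy) (mul_nonneg hμ.le hy') (mul_le_mul_of_nonneg_left h hμ.le)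
  have hV1 : V 1 = 0 := by rw [hV 1 (Set.mem_Ici.2 le_rfl), intervalIntegral.integral_same]
  have hq0 : ∀ u ∈ Set.Ici (0 : ℝ), q u 0 = (K u)⁻¹ := by
    intro u hu
    rw [hq u hu 0 (by simp)]
    simp [hV1, hKdef]
  have hinteg : ∀ t > (0 : ℝ), IntervalIntegrable (fun u => (K u)⁻¹) volume 0 t := by
    intro t ht
    obtain ⟨T, hQT, hT⟩ := ((hQtop.eventually_gt_atTop 0).and (eventually_ge_atTop t)).exists
    have hT0 : 0 ≤ T := ht.le.trans hT
    have h : IntervalIntegrable (fun u => q u 0) volume 0 T := by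
      by_contra h
      rw [hQ, intervalIntegral.integral_undef h] at hQT
      exact hQT.false
    rw [intervalIntegrable_iff_integrableOn_Ioc_of_le hT0] at h
    rw [intervalIntegrable_iff_integrableOn_Ioc_of_le ht.le]
    exact (h.mono_set (Set.Ioc_subset_Ioc_right hT)).congr_fun
      (fun u hu => hq0 u hu.1.le) measurableSet_Ioc
  have hRpos : 0 < ∫ v in Set.Ioi 0, r v := by
    refine (setIntegral_pos_iff_support_of_nonneg_ae ?_ hRfin).2 ?_
    · exact (ae_restrict_mem measurableSet_Ioi).mono fun v hv => (hrpos v hv).le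
    · have hsub : Set.Ioi 0 ⊆ Function.support r := fun v hv => (hrpos v hv).ne'
      simp [Set.inter_eq_right.2 hsub]
  have hI0 : Tendsto (fun t => K t * I t 0) atTop (nhds (∫ v in Set.Ioi 0, r v)) := by
    refine (RegularlyVarying.tendsto_mul_convolution hθ hrpos hranti hRfin hrrv hKrv hKmono hKtop hinteg).congr' ?_
    filter_upwards [eventually_ge_atTop 0] with t ht
    rw [hI]
    congr 1
    refine intervalIntegral.integral_congr fun u hu => ?_
    rw [Set.uIcc_of_le ht] at hu
    simp only [hq0 u hu.1]
  set p : ℝ → ℝ := fun t => V (1 / (1 - Real.exp (-(lam / W (μ * t))))) / μ with hpdef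
  have hpt : Tendsto (fun t => p t / t) atTop (nhds ((1 / lam) ^ γ)) := by
    have hWμ : Tendsto (fun t => W (μ * t)) atTop atTop := hWtop.comp hμt
    have h1 : Tendsto (fun t => W (μ * t) * (1 - Real.exp (-(lam / W (μ * t))))) atTop
        (nhds lam) := by
      refine tendsto_mul_one_sub_exp_neg hWμ (tendsto_const_nhds.congr' ?_)
      filter_upwards [hWμ.eventually_ne_atTop 0] with t ht
      rw [mul_div_cancel₀ _ ht]
    have h2 : Tendsto (fun t => 1 / (1 - Real.exp (-(lam / W (μ * t)))) / W (μ * t)) atTop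
        (nhds (1 / lam)) := by
      rw [one_div]
      refine (h1.inv₀ hlam.ne').congr fun t => ?_
      rw [mul_inv_rev, one_div, ← div_eq_mul_inv]
    have h3 := hVrv.tendsto_div_of_monotoneOn hVmono (hVtop.eventually_gt_atTop 0) hWμ h2
      (by positivity)
    refine h3.congr' ?_
    filter_upwards [eventually_ge_atTop 0] with t ht
    rw [hVW _ (mul_nonneg hμ.le ht), hpdef, div_div]
  have hI1 : Tendsto (fun t => K t * I t (Real.exp (-(lam / W (μ * t))))) atTop
      (nhds ((∫ v in Set.Ioi 0, r v) * (1 + (1 / lam) ^ γ)⁻¹)) := by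
    refine (hKrv.tendsto_mul_convolution_shift hRfin hKmono hKtop (by positivity) hpt).congr' ?_
    filter_upwards [eventually_ge_atTop 0] with t ht
    rw [hI]
    congr 1
    refine intervalIntegral.integral_congr fun u hu => ?_
    rw [Set.uIcc_of_le ht] at hu
    have hWpos : 0 < W (μ * t) := zero_lt_one.trans_le (hWmem _ (mul_nonneg hμ.le ht))
    have hs : Real.exp (-(lam / W (μ * t))) ∈ Set.Ico (0 : ℝ) 1 :=
      ⟨(Real.exp_pos _).le, Real.exp_lt_one_iff.2 (neg_lt_zero.2 (div_pos hlam hWpos))⟩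
    simp only [hq u hu.1 _ hs, hKdef, hpdef, mul_add, mul_div_cancel₀ _ hμ.ne', one_div]
  have hlim := (tendsto_mul_one_sub_exp_neg hKtop hI1).div
    (tendsto_mul_one_sub_exp_neg hKtop hI0) hRpos.ne'
  have hval : (∫ v in Set.Ioi 0, r v) * (1 + (1 / lam) ^ γ)⁻¹ / (∫ v in Set.Ioi 0, r v) =
      lam ^ α * (1 + lam ^ γ) ^ (-(α / γ)) := by
    have hlamγ : 0 < lam ^ γ := Real.rpow_pos_of_pos hlam γ
    rw [hαγ, hαγ', Real.rpow_neg_one, Real.div_rpow zero_le_one hlam.le, Real.one_rpow]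
    field_simp
    ring
  rw [hval] at hlim
  refine hlim.congr' ?_
  filter_upwards [hKtop.eventually_ne_atTop 0] with t ht
  simp only [Pi.div_apply, hΦ]
  rw [mul_div_mul_left _ _ ht]
end

section
/- Assume θ = 1 and α = γ, that R(t) increases to R∞ ≤ ∞ and Q(t) increases to ∞, and that r(t)Q(t)/(q(t)R(t)) → d ≥ 0 as t → ∞. Then for every λ > 0, taking s_λ(t) = exp(−λ/W(μt)), one has (1 − Φ(t; s_λ(t)))/(1 − Φ(t;0)) → (1 + λ^{−γ})^{−1}/(1 + d) as t → ∞; equivalently, E[exp(−λ Y(t)/W(μt)) | Y(t) > 0] converges to d/(1+d) + (1/(1+d))·1/(1 + λ^γ). -/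
section

open Filter MeasureTheory Topology

/-- A one-parameter squeeze theorem: upper and lower bounds whose limits approach `m`. -/
lemma tendsto_of_approx_bounds {f a b : ℝ → ℝ} {m : ℝ}
    (ha : Tendsto a (𝓝[>] 0) (𝓝 m)) (hb : Tendsto b (𝓝[>] 0) (𝓝 m))
    (hlo : ∀ᶠ ε in 𝓝[>] (0 : ℝ), ∃ g : ℝ → ℝ, Tendsto g atTop (𝓝 (a ε)) ∧ ∀ᶠ t in atTop, g t ≤ f t)
    (hhi : ∀ᶠ ε in 𝓝[>] (0 : ℝ), ∃ g : ℝ → ℝ, Tendsto g atTop (𝓝 (b ε)) ∧ ∀ᶠ t in atTop, f t ≤ g t) :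
    Tendsto f atTop (𝓝 m) := by
  rw [tendsto_order]
  constructor
  · intro x hx
    obtain ⟨ε, hε, g, hg, hgf⟩ := ((ha.eventually_const_lt hx).and hlo).exists
    filter_upwards [hg.eventually_const_lt hε, hgf] with t h1 h2 using h1.trans_le h2
  · intro x hx
    obtain ⟨ε, hε, g, hg, hgf⟩ := ((hb.eventually_lt_const hx).and hhi).exists
    filter_upwards [hg.eventually_lt_const hε, hgf] with t h1 h2 using h2.trans_lt h1

/-- A quotient rule at infinity for `F (c * x) / F x`, where `F` is a primitive of `f`. -/
lemma tendsto_primitive_ratio {f F : ℝ → ℝ} {T c k : ℝ} (hc : 0 < c)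
    (hF : ∀ x > T, ∀ y ≥ x, F y - F x = ∫ u in x..y, f u)
    (hint : ∀ x > T, ∀ y ≥ x, IntervalIntegrable f volume x y)
    (hpos : ∀ u > T, 0 < f u)
    (hlim : Tendsto (fun u => c * f (c * u) / f u) atTop (𝓝 k))
    (hFtop : Tendsto F atTop atTop) :
    Tendsto (fun x => F (c * x) / F x) atTop (𝓝 k) := by
  rw [Metric.tendsto_atTop'] 
  intro ε hε
  obtain ⟨X, hX⟩ := eventually_atTop.1
    (((Metric.tendsto_nhds.1 hlim (ε / 2) (by positivity)).and (eventually_gt_atTop T)).and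
      ((tendsto_id.const_mul_atTop hc).eventually_gt_atTop T))
  set C := |F (c * X) - k * F X| + ε / 2 * |F X| with hC
  obtain ⟨Y, hY⟩ := eventually_atTop.1
    ((hFtop.eventually_gt_atTop (2 * C / ε)).and (hFtop.eventually_gt_atTop 0))
  refine ⟨max X Y, fun x hx => ?_⟩
  have hxX : X ≤ x := (le_max_left _ _).trans hx.le
  obtain ⟨hFx1, hFx0⟩ := hY x ((le_max_right _ _).trans hx.le)
  have hcX : T < c * X := (hX X le_rfl).2
  have hTX : T < X := (hX X le_rfl).1.2
  have h1 : F (c * x) - F (c * X) = ∫ u in X..x, c * f (c * u) := by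
    rw [hF _ hcX _ (by gcongr), intervalIntegral.integral_const_mul,
      intervalIntegral.mul_integral_comp_mul_left]
  have h2 := hF X hTX x hxX
  have hi := hint X hTX x hxX
  have hi' : IntervalIntegrable (fun u => c * f (c * u)) volume X x := by
    have := (hint _ hcX (c * x) (by gcongr)).comp_mul_left (c := c)
    rw [mul_div_cancel_left₀ _ hc.ne', mul_div_cancel_left₀ _ hc.ne'] at this
    exact this.const_mul c
  have hb : ∀ u ∈ Set.Icc X x, (k - ε / 2) * f u ≤ c * f (c * u) ∧
      c * f (c * u) ≤ (k + ε / 2) * f u := by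
    intro u hu
    have hfu := hpos u (hTX.trans_le hu.1)
    have := (hX u hu.1).1.1
    rw [Real.dist_eq, abs_lt] at this
    constructor
    · rw [← le_div_iff₀ hfu]; linarith
    · rw [← div_le_iff₀ hfu]; linarith
  have h3 := intervalIntegral.integral_mono_on hxX (hi.const_mul (k - ε / 2)) hi'
    fun u hu => (hb u hu).1
  have h4 := intervalIntegral.integral_mono_on hxX hi' (hi.const_mul (k + ε / 2))
    fun u hu => (hb u hu).2
  rw [← h1, intervalIntegral.integral_const_mul, ← h2] at h3 h4
  have hCε : 2 * C < ε * F x := by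
    rw [div_lt_iff₀ hε] at hFx1; linarith
  have e1 := abs_le.1 (le_refl |F (c * X) - k * F X|)
  have e2 : |ε / 2 * F X| = ε / 2 * |F X| := by rw [abs_mul, abs_of_pos (half_pos hε)]
  have e3 := abs_le.1 e2.le
  rw [Real.dist_eq, abs_lt]
  constructor
  · rw [lt_sub_iff_add_lt, lt_div_iff₀ hFx0]; linarith
  · rw [sub_lt_iff_lt_add, div_lt_iff₀ hFx0]; linarith

lemma intervalIntegrable_mul {f g : ℝ → ℝ} {x y A B : ℝ} (hxy : x ≤ y)
    (hg : IntervalIntegrable g volume x y)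
    (hf : AEMeasurable f (volume.restrict (Set.Ioo x y)))
    (hA : ∀ u ∈ Set.Ioo x y, A ≤ f u) (hB : ∀ u ∈ Set.Ioo x y, f u ≤ B) :
    IntervalIntegrable (fun u => f u * g u) volume x y := by
  rw [intervalIntegrable_iff_integrableOn_Ioo_of_le hxy] at hg ⊢
  refine Integrable.bdd_mul (c := max |A| |B|) hg hf.aestronglyMeasurable ?_
  refine (ae_restrict_iff' measurableSet_Ioo).2 (ae_of_all _ fun u hu => ?_)
  exact abs_le_max_abs_abs (hA u hu) (hB u hu)

lemma integral_mul_bounds {f g : ℝ → ℝ} {x y A B : ℝ} (hxy : x ≤ y)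
    (hg : IntervalIntegrable g volume x y) (hg0 : ∀ u ∈ Set.Ioo x y, 0 ≤ g u)
    (hf : AEMeasurable f (volume.restrict (Set.Ioo x y)))
    (hA : ∀ u ∈ Set.Ioo x y, A ≤ f u) (hB : ∀ u ∈ Set.Ioo x y, f u ≤ B) :
    IntervalIntegrable (fun u => f u * g u) volume x y ∧
      A * (∫ u in x..y, g u) ≤ ∫ u in x..y, f u * g u ∧
      ∫ u in x..y, f u * g u ≤ B * ∫ u in x..y, g u := by
  have hi := intervalIntegrable_mul hxy hg hf hA hB
  refine ⟨hi, ?_, ?_⟩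
  · rw [← intervalIntegral.integral_const_mul]
    exact intervalIntegral.integral_mono_on_of_le_Ioo hxy (hg.const_mul A) hi
      fun u hu => mul_le_mul_of_nonneg_right (hA u hu) (hg0 u hu)
  · rw [← intervalIntegral.integral_const_mul]
    exact intervalIntegral.integral_mono_on_of_le_Ioo hxy hi (hg.const_mul B)
      fun u hu => mul_le_mul_of_nonneg_right (hB u hu) (hg0 u hu)

/-- `F` is the primitive of `f`, and `f` is positive and non-increasing beyond `T` and regularly
varying at infinity with index `-1`. -/
structure IsInvRegVarying (T : ℝ) (f F : ℝ → ℝ) : Prop where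
  nonneg : 0 ≤ T
  pos : ∀ t > T, 0 < f t
  anti : AntitoneOn f (Set.Ioi T)
  int : ∀ t ≥ 0, IntervalIntegrable f volume 0 t
  primitive : ∀ t, F t = ∫ u in (0 : ℝ)..t, f u
  ratio : ∀ c > 0, Tendsto (fun t => f (c * t) / f t) atTop (𝓝 c⁻¹)

namespace IsInvRegVarying

variable {T : ℝ} {f F : ℝ → ℝ}

lemma intervalIntegrable (h : IsInvRegVarying T f F) {x y : ℝ} (hx : 0 ≤ x) (hy : 0 ≤ y) :
    IntervalIntegrable f volume x y :=
  (h.int x hx).symm.trans (h.int y hy)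

lemma sub_eq (h : IsInvRegVarying T f F) {x y : ℝ} (hx : 0 ≤ x) (hy : 0 ≤ y) :
    F y - F x = ∫ u in x..y, f u := by
  rw [h.primitive, h.primitive, intervalIntegral.integral_interval_sub_left (h.int y hy) (h.int x hx)]

lemma slow_of_tendsto_atTop (h : IsInvRegVarying T f F) (hF : Tendsto F atTop atTop)
    {c : ℝ} (hc : 0 < c) : Tendsto (fun t => F (c * t) / F t) atTop (𝓝 1) := by
  refine tendsto_primitive_ratio (f := f) (T := T) hc
    (fun x hx y hy => h.sub_eq (h.nonneg.trans hx.le) ((h.nonneg.trans hx.le).trans hy))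
    (fun x hx y hy => h.intervalIntegrable (h.nonneg.trans hx.le) ((h.nonneg.trans hx.le).trans hy))
    h.pos ?_ hF
  have := (h.ratio c hc).const_mul c
  rw [mul_inv_cancel₀ hc.ne'] at this
  simpa only [mul_div_assoc] using this

lemma monotoneOn (h : IsInvRegVarying T f F) : MonotoneOn F (Set.Ici T) := by
  intro x hx y hy hxy
  have hx0 := h.nonneg.trans (Set.mem_Ici.1 hx)
  have hy0 := h.nonneg.trans (Set.mem_Ici.1 hy)
  rw [← sub_nonneg, h.sub_eq hx0 hy0]
  have := intervalIntegral.integral_mono_on_of_le_Ioo hxy (f := fun _ => (0 : ℝ)) (by simp)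
    (h.intervalIntegrable hx0 hy0) fun u hu => (h.pos u (lt_of_le_of_lt hx hu.1)).le
  simpa using this

lemma primitive_zero (h : IsInvRegVarying T f F) : F 0 = 0 := by simp [h.primitive]

lemma primitive_pos (h : IsInvRegVarying 0 f F) {t : ℝ} (ht : 0 < t) : 0 < F t := by
  rw [h.primitive]
  exact intervalIntegral.intervalIntegral_pos_of_pos_on (h.int t ht.le) (fun u hu => h.pos u hu.1) ht

lemma slow_of_zero (h : IsInvRegVarying 0 f F)
    {c : ℝ} (hc : 0 < c) : Tendsto (fun t => F (c * t) / F t) atTop (𝓝 1) := by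
  have hm : Monotone (fun t => F (max 0 t)) := fun x y hxy =>
    h.monotoneOn (Set.mem_Ici.2 (le_max_left _ _)) (Set.mem_Ici.2 (le_max_left _ _)) (max_le_max le_rfl hxy)
  have he : (fun t => F (max 0 t)) =ᶠ[atTop] F := by
    filter_upwards [eventually_ge_atTop 0] with t ht
    rw [max_eq_right ht]
  rcases tendsto_atTop_of_monotone hm with h1 | ⟨l, h1⟩
  · exact h.slow_of_tendsto_atTop (h1.congr' he) hc
  · have hl : 0 < l := (h.primitive_pos one_pos).trans_le (by
      simpa using hm.ge_of_tendsto h1 1)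
    have h2 := h1.congr' he
    have := (h2.comp (tendsto_id.const_mul_atTop hc)).div h2 hl.ne'
    rwa [div_self hl.ne'] at this

lemma aemeasurable_Ioo (h : IsInvRegVarying T f F) {x y : ℝ} (hx : T ≤ x) :
    AEMeasurable f (volume.restrict (Set.Ioo x y)) :=
  aemeasurable_restrict_of_antitoneOn measurableSet_Ioo
    (h.anti.mono fun _ hu => hx.trans_lt hu.1)

lemma aemeasurable_reflect (h : IsInvRegVarying 0 f F) {t x y : ℝ} (hy : y ≤ t) :
    AEMeasurable (fun u => f (t - u)) (volume.restrict (Set.Ioo x y)) :=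
  aemeasurable_restrict_of_monotoneOn measurableSet_Ioo fun _ hu _ hv huv =>
    h.anti (sub_pos.2 (hv.2.trans_le hy)) (sub_pos.2 (hu.2.trans_le hy)) (sub_le_sub_left huv t)

lemma intervalIntegrable_reflect (h : IsInvRegVarying 0 f F) {t x y : ℝ} (hx : x ≤ t) (hy : y ≤ t) :
    IntervalIntegrable (fun u => f (t - u)) volume x y := by
  have := (h.intervalIntegrable (sub_nonneg.2 hx) (sub_nonneg.2 hy)).comp_sub_left t
  simpa using this

lemma integral_reflect (h : IsInvRegVarying 0 f F) {t x y : ℝ} (hx : x ≤ t) (hy : y ≤ t) :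
    ∫ u in x..y, f (t - u) = F (t - x) - F (t - y) := by
  rw [intervalIntegral.integral_comp_sub_left, h.sub_eq (sub_nonneg.2 hy) (sub_nonneg.2 hx)]

variable {q r Q R : ℝ → ℝ}

lemma tendsto_mul_zero (hr : IsInvRegVarying 0 r R) (hq : IsInvRegVarying T q Q) :
    Tendsto (fun t => q t * R t) atTop (𝓝 0) := by
  have h2 : Tendsto (fun t => (q (2 * t) / q t) * (R (2 * t) / R t)) atTop (𝓝 (2⁻¹ * 1)) :=
    (hq.ratio 2 two_pos).mul (hr.slow_of_zero two_pos)
  obtain ⟨S, hS⟩ := eventually_atTop.1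
    ((h2.eventually_lt_const (show (2⁻¹ * 1 : ℝ) < 3 / 4 by norm_num)).and
      ((eventually_gt_atTop T).and (eventually_gt_atTop 0)))
  have hST := (hS S le_rfl).2.1
  have hS0 := (hS S le_rfl).2.2
  have hpos : ∀ t ≥ S, 0 < q t * R t := fun t ht =>
    mul_pos (hq.pos t (hST.trans_le ht)) (hr.primitive_pos (hS0.trans_le ht))
  have hstep : ∀ t ≥ 2 * S, q t * R t ≤ 3 / 4 * (q (t / 2) * R (t / 2)) := by
    intro t ht
    have ht' : S ≤ t / 2 := by linarith
    have h := (hS (t / 2) ht').1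
    rw [mul_div_cancel₀ t two_ne_zero, div_mul_div_comm, div_lt_iff₀ (hpos _ ht')] at h
    exact h.le
  set B := q S * R (2 * S) with hB
  have hB0 : 0 < B := mul_pos (hq.pos S hST) (hr.primitive_pos (by linarith))
  have hbase : ∀ t ∈ Set.Icc S (2 * S), q t * R t ≤ B := by
    intro t ht
    refine mul_le_mul (hq.anti hST (hST.trans_le ht.1) ht.1)
      (hr.monotoneOn (hS0.le.trans ht.1) (by simp; linarith) ht.2)
      (hr.primitive_pos (hS0.trans_le ht.1)).le (hq.pos S hST).le
  have hbdd : ∀ n : ℕ, ∀ t ∈ Set.Icc S (2 ^ n * S), q t * R t ≤ B := by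
    intro n
    induction n with
    | zero => exact fun t ht => hbase t ⟨ht.1, by have := ht.2; simp at this; linarith⟩
    | succ n ih =>
      intro t ht
      rcases le_total t (2 * S) with h | h
      · exact hbase t ⟨ht.1, h⟩
      · have := ih (t / 2) ⟨by linarith, by have := ht.2; rw [pow_succ] at this; linarith⟩
        linarith [hstep t h, hpos t ht.1]
  have hbdd' : ∀ t ≥ S, q t * R t ≤ B := by
    intro t ht
    obtain ⟨n, hn⟩ := pow_unbounded_of_one_lt (t / S) (one_lt_two (α := ℝ))
    exact hbdd n t ⟨ht, ((div_lt_iff₀ hS0).1 hn).le⟩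
  have hgeom : ∀ n : ℕ, ∀ t ≥ 2 ^ n * S, q t * R t ≤ (3 / 4) ^ n * B := by
    intro n
    induction n with
    | zero => exact fun t ht => by simpa using hbdd' t (by simpa using ht)
    | succ n ih =>
      intro t ht
      have h1 : (1 : ℝ) ≤ 2 ^ n := one_le_pow₀ one_le_two
      rw [pow_succ] at ht ⊢
      have h2 : 2 ^ n * S ≤ t / 2 := by linarith
      have := ih (t / 2) h2
      have := hstep t (by nlinarith)
      linarith
  refine Metric.tendsto_atTop.2 fun ε hε => ?_
  obtain ⟨n, hn⟩ := exists_pow_lt_of_lt_one (div_pos hε hB0) (show (3 / 4 : ℝ) < 1 by norm_num)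
  refine ⟨max S (2 ^ n * S), fun t ht => ?_⟩
  rw [Real.dist_0_eq_abs, abs_of_pos (hpos t ((le_max_left _ _).trans ht))]
  exact (hgeom n t ((le_max_right _ _).trans ht)).trans_lt ((lt_div_iff₀ hB0).1 hn)

lemma abs_integral_reflect_mul_le (hr : IsInvRegVarying 0 r R) {g : ℝ → ℝ} {b t : ℝ} (hb : 0 ≤ b)
    (ht : 2 * b < t) (hg : IntervalIntegrable g volume 0 b) :
    IntervalIntegrable (fun u => r (t - u) * g u) volume 0 b ∧
      |∫ u in (0 : ℝ)..b, r (t - u) * g u| ≤ r (2⁻¹ * t) * ∫ u in (0 : ℝ)..b, |g u| := by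
  have hpos : ∀ u ∈ Set.Ioo 0 b, 0 ≤ r (t - u) := fun u hu =>
    (hr.pos _ (by linarith [hu.1, hu.2])).le
  have hle : ∀ u ∈ Set.Ioo 0 b, r (t - u) ≤ r (2⁻¹ * t) := fun u hu =>
    hr.anti (by simp; linarith) (by simp; linarith [hu.2]) (by linarith [hu.2])
  have hm : AEMeasurable (fun u => r (t - u)) (volume.restrict (Set.Ioo 0 b)) :=
    hr.aemeasurable_reflect (by linarith)
  refine ⟨intervalIntegrable_mul hb hg hm hpos hle, ?_⟩
  refine (intervalIntegral.abs_integral_le_integral_abs hb).trans ?_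
  refine le_trans (le_of_eq ?_)
    (integral_mul_bounds hb hg.abs (fun _ _ => abs_nonneg _) hm hpos hle).2.2
  rw [intervalIntegral.integral_of_le hb, intervalIntegral.integral_of_le hb,
    integral_Ioc_eq_integral_Ioo, integral_Ioc_eq_integral_Ioo]
  refine setIntegral_congr_fun measurableSet_Ioo fun u hu => ?_
  simp only [abs_mul, abs_of_nonneg (hpos u hu)]

/-- Away from the origin, the convolution of `r` with a function with bounds `A` and `B`. -/
lemma integral_reflect_mul_bounds (hr : IsInvRegVarying 0 r R) {g : ℝ → ℝ} {x y t A B : ℝ}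
    (hxy : x ≤ y) (hyt : y ≤ t) (hg : AEMeasurable g (volume.restrict (Set.Ioo x y)))
    (hA : ∀ u ∈ Set.Ioo x y, A ≤ g u) (hB : ∀ u ∈ Set.Ioo x y, g u ≤ B) :
    IntervalIntegrable (fun u => r (t - u) * g u) volume x y ∧
      A * (R (t - x) - R (t - y)) ≤ ∫ u in x..y, r (t - u) * g u ∧
      ∫ u in x..y, r (t - u) * g u ≤ B * (R (t - x) - R (t - y)) := by
  have := integral_mul_bounds hxy (hr.intervalIntegrable_reflect (hxy.trans hyt) hyt)
    (fun u hu => (hr.pos _ (sub_pos.2 (hu.2.trans_le hyt))).le) hg hA hB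
  simpa only [mul_comm (g _), hr.integral_reflect (hxy.trans hyt) hyt] using this

lemma convolution_bounds (hr : IsInvRegVarying 0 r R) (hq : IsInvRegVarying T q Q)
    {b ε t : ℝ} (hb : T < b) (hε : 0 < ε) (hε2 : ε < 1 / 2) (hbt : b < ε * t) :
    -(r (2⁻¹ * t) * ∫ u in (0 : ℝ)..b, |q u|) + r t * (Q (ε * t) - Q b) + q t * R ((1 - ε) * t)
        ≤ ∫ u in (0 : ℝ)..t, r (t - u) * q u ∧
      ∫ u in (0 : ℝ)..t, r (t - u) * q u ≤
        (r (2⁻¹ * t) * ∫ u in (0 : ℝ)..b, |q u|) + r ((1 - ε) * t) * (Q (ε * t) - Q b) +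
          q (ε * t) * (R ((1 - ε) * t) - R (ε * t)) + q ((1 - ε) * t) * R (ε * t) := by
  have hb0 : 0 < b := hq.nonneg.trans_lt hb
  have ht0 : 0 < t := by
    by_contra! h
    nlinarith
  have hεt : ε * t < 1 / 2 * t := by gcongr
  have hε't : 1 / 2 * t < (1 - ε) * t := by gcongr; linarith
  have hsplit : (1 - ε) * t = t - ε * t := by ring
  obtain ⟨i1, j1⟩ := hr.abs_integral_reflect_mul_le hb0.le (t := t) (by linarith) (hq.int b hb0.le)
  obtain ⟨i2, j2, j2'⟩ := integral_mul_bounds (f := fun u => r (t - u)) (g := q) hbt.le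
    (hq.intervalIntegrable hb0.le (by linarith)) (fun u hu => (hq.pos u (hb.trans hu.1)).le)
    (hr.aemeasurable_reflect (by linarith)) (A := r t) (B := r ((1 - ε) * t))
    (fun u hu => hr.anti (by simp; linarith [hu.2]) ht0 (by linarith [hu.1]))
    (fun u hu => hr.anti (by simp only [Set.mem_Ioi]; linarith)
      (by simp only [Set.mem_Ioi]; linarith [hu.2]) (by linarith [hu.2]))
  obtain ⟨i3, j3, j3'⟩ := hr.integral_reflect_mul_bounds (g := q) (x := ε * t) (y := (1 - ε) * t)
    (t := t) (by linarith) (by linarith) (hq.aemeasurable_Ioo (by linarith)) (A := q t)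
    (B := q (ε * t))
    (fun u hu => hq.anti (by simp only [Set.mem_Ioi]; linarith [hu.1])
      (by simp only [Set.mem_Ioi]; linarith) (by linarith [hu.2]))
    (fun u hu => hq.anti (by simp only [Set.mem_Ioi]; linarith)
      (by simp only [Set.mem_Ioi]; linarith [hu.1]) hu.1.le)
  obtain ⟨i4, j4, j4'⟩ := hr.integral_reflect_mul_bounds (g := q) (x := (1 - ε) * t) (y := t)
    (t := t) (by linarith) (by linarith) (hq.aemeasurable_Ioo (by linarith)) (A := q t)
    (B := q ((1 - ε) * t))
    (fun u hu => hq.anti (by simp only [Set.mem_Ioi]; linarith [hu.1])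
      (by simp only [Set.mem_Ioi]; linarith) (by linarith [hu.2]))
    (fun u hu => hq.anti (by simp only [Set.mem_Ioi]; linarith)
      (by simp only [Set.mem_Ioi]; linarith [hu.1]) hu.1.le)
  rw [← intervalIntegral.integral_add_adjacent_intervals ((i1.trans i2).trans i3) i4,
    ← intervalIntegral.integral_add_adjacent_intervals (i1.trans i2) i3,
    ← intervalIntegral.integral_add_adjacent_intervals i1 i2]
  rw [← hq.sub_eq hb0.le (by linarith)] at j2 j2'
  have e1 : t - (1 - ε) * t = ε * t := by ring
  rw [← hsplit, e1] at j3 j3'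
  rw [e1, sub_self, hr.primitive_zero] at j4 j4'
  have := abs_le.1 j1
  constructor <;> linarith

/-- The convolution `r * q` is asymptotic to `r Q + q R`. -/
lemma convolution_asymptotics (hr : IsInvRegVarying 0 r R) (hq : IsInvRegVarying T q Q)
    (hQ : Tendsto Q atTop atTop) {d : ℝ}
    (hd : Tendsto (fun t => r t * Q t / (q t * R t)) atTop (𝓝 d)) :
    Tendsto (fun t => (∫ u in (0 : ℝ)..t, r (t - u) * q u) / (q t * R t)) atTop (𝓝 (1 + d)) := by
  obtain ⟨b, hb⟩ := exists_gt T
  set K := ∫ u in (0 : ℝ)..b, |q u|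
  set X : ℝ → ℝ := fun t => r t * Q t / (q t * R t) with hX
  have hsmall : ∀ᶠ ε in 𝓝[>] (0 : ℝ), 0 < ε ∧ ε < 1 / 2 :=
    eventually_mem_nhdsWithin.and
      (mem_nhdsWithin_of_mem_nhds (eventually_lt_nhds (by norm_num : (0 : ℝ) < 1 / 2)))
  have hQi : Tendsto (fun t => (Q t)⁻¹) atTop (𝓝 0) := hQ.inv_tendsto_atTop
  have hK : Tendsto (fun t => (r (2⁻¹ * t) / r t) * K * (X t * (Q t)⁻¹)) atTop (𝓝 0) := by
    have := ((hr.ratio 2⁻¹ (by norm_num)).mul_const K).mul (hd.mul hQi)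
    simpa using this
  have hQb : ∀ ε > 0, Tendsto (fun t => Q (ε * t) / Q t - Q b * (Q t)⁻¹) atTop (𝓝 1) := by
    intro ε hε
    simpa using (hq.slow_of_tendsto_atTop hQ hε).sub (hQi.const_mul (Q b))
  have hev : ∀ ε > 0, ∀ᶠ t in atTop, b < ε * t ∧ 0 < r t ∧ 0 < q t ∧ 0 < R t ∧ 0 < Q t := by
    intro ε hε
    filter_upwards [(tendsto_id.const_mul_atTop hε).eventually_gt_atTop b, eventually_gt_atTop 0,
      eventually_gt_atTop T, hQ.eventually_gt_atTop 0] with t h1 h2 h3 h4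
    exact ⟨h1, hr.pos t h2, hq.pos t h3, hr.primitive_pos h2, h4⟩
  refine tendsto_of_approx_bounds (a := fun _ => 1 + d)
    (b := fun ε => (1 - ε)⁻¹ * d + (1 - ε)⁻¹) tendsto_const_nhds ?_ ?_ ?_
  · have : ContinuousAt (fun ε : ℝ => (1 - ε)⁻¹ * d + (1 - ε)⁻¹) 0 := by
      have : ContinuousAt (fun ε : ℝ => (1 - ε)⁻¹) 0 :=
        (continuousAt_const.sub continuousAt_id).inv₀ (by norm_num)
      fun_prop
    have h := this.tendsto.mono_left (nhdsWithin_le_nhds (s := Set.Ioi 0))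
    simp only [sub_zero, inv_one, one_mul] at h
    rwa [add_comm]
  · filter_upwards [hsmall] with ε hε
    have h1ε : 0 < 1 - ε := by linarith
    refine ⟨fun t => -((r (2⁻¹ * t) / r t) * K * (X t * (Q t)⁻¹)) +
      X t * (Q (ε * t) / Q t - Q b * (Q t)⁻¹) + R ((1 - ε) * t) / R t, ?_, ?_⟩
    · have := (hK.neg.add (hd.mul (hQb ε hε.1))).add (hr.slow_of_zero h1ε)
      simpa [add_comm] using this
    · filter_upwards [hev ε hε.1] with t ⟨h1, h2, h3, h4, h5⟩
      rw [le_div_iff₀ (mul_pos h3 h4)]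
      refine le_trans (le_of_eq ?_) (convolution_bounds hr hq hb hε.1 hε.2 h1).1
      simp only [hX]
      field_simp
      ring
  · filter_upwards [hsmall] with ε hε
    have h1ε : 0 < 1 - ε := by linarith
    refine ⟨fun t => (r (2⁻¹ * t) / r t) * K * (X t * (Q t)⁻¹) +
      (r ((1 - ε) * t) / r t) * (X t * (Q (ε * t) / Q t - Q b * (Q t)⁻¹)) +
      (q (ε * t) / q t) * (R ((1 - ε) * t) / R t - R (ε * t) / R t) +
      (q ((1 - ε) * t) / q t) * (R (ε * t) / R t), ?_, ?_⟩
    · have := ((hK.add ((hr.ratio _ h1ε).mul (hd.mul (hQb ε hε.1)))).add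
        ((hq.ratio ε hε.1).mul ((hr.slow_of_zero h1ε).sub (hr.slow_of_zero hε.1)))).add
        ((hq.ratio _ h1ε).mul (hr.slow_of_zero hε.1))
      simpa using this
    · filter_upwards [hev ε hε.1] with t ⟨h1, h2, h3, h4, h5⟩
      rw [div_le_iff₀ (mul_pos h3 h4)]
      refine le_trans (convolution_bounds hr hq hb hε.1 hε.2 h1).2 (le_of_eq ?_)
      simp only [hX]
      field_simp
      ring

/-- Convolution of `r` with a perturbation `p t` of the shifted function `u ↦ q (u + κ t)`. -/
lemma shifted_convolution_asymptotics (hr : IsInvRegVarying 0 r R) (hq : IsInvRegVarying T q Q)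
    {κ : ℝ} (hκ : 0 < κ) {p : ℝ → ℝ → ℝ}
    (hanti : ∀ᶠ t in atTop, AntitoneOn (p t) (Set.Ioi 0))
    (hlo : ∀ ε > 0, ∀ᶠ t in atTop, ∀ u > 0, q (u + (κ + ε) * t) ≤ p t u)
    (hhi : ∀ ε > 0, ε < κ → ∀ᶠ t in atTop, ∀ u > 0, p t u ≤ q (u + (κ - ε) * t)) :
    Tendsto (fun t => (∫ u in (0 : ℝ)..t, r (t - u) * p t u) / (q t * R t)) atTop
      (𝓝 (1 + κ)⁻¹) := by
  have hsmall : ∀ᶠ ε in 𝓝[>] (0 : ℝ), 0 < ε ∧ ε < κ / 2 ∧ ε < 1 / 2 :=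
    eventually_mem_nhdsWithin.and (mem_nhdsWithin_of_mem_nhds
      ((eventually_lt_nhds (by positivity)).and (eventually_lt_nhds (by norm_num))))
  have hcont : ∀ k : ℝ, Tendsto (fun ε : ℝ => (1 + κ + k * ε)⁻¹) (𝓝[>] 0) (𝓝 (1 + κ)⁻¹) := by
    intro k
    have : ContinuousAt (fun ε : ℝ => (1 + κ + k * ε)⁻¹) 0 :=
      (by fun_prop : ContinuousAt (fun ε : ℝ => 1 + κ + k * ε) 0).inv₀ (by simp; positivity)
    simpa using this.tendsto.mono_left (nhdsWithin_le_nhds (s := Set.Ioi 0))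
  have hmeas : ∀ᶠ t in atTop, ∀ x ≥ 0, ∀ y,
      AEMeasurable (p t) (volume.restrict (Set.Ioo x y)) := by
    filter_upwards [hanti] with t h x hx y
    exact aemeasurable_restrict_of_antitoneOn measurableSet_Ioo
      (h.mono fun u hu => lt_of_le_of_lt hx hu.1)
  refine tendsto_of_approx_bounds (hcont 1) (hcont (-2)) ?_ ?_
  · filter_upwards [hsmall] with ε ⟨hε, hεκ, hε1⟩
    have hpos : 0 < 1 + κ + 1 * ε := by positivity
    refine ⟨_, hq.ratio _ hpos, ?_⟩
    filter_upwards [hmeas, hlo ε hε, hhi (κ / 2) (by positivity) (by linarith),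
      eventually_gt_atTop 0, eventually_gt_atTop T,
      (tendsto_id.const_mul_atTop (half_pos hκ)).eventually_gt_atTop T]
      with t hm hl hh ht hT hκT
    simp only [id] at hκT
    have hd : 0 < q t * R t := mul_pos (hq.pos t hT) (hr.primitive_pos ht)
    have hκt : 0 < κ * t := by positivity
    have hεt : 0 < ε * t := by positivity
    obtain ⟨-, h, -⟩ := hr.integral_reflect_mul_bounds (g := p t) ht.le le_rfl (hm 0 le_rfl t)
      (A := q ((1 + κ + 1 * ε) * t)) (B := q (κ / 2 * t))
      (fun u hu => le_trans (hq.anti (by simp only [Set.mem_Ioi]; linarith [hu.1])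
        (by simp only [Set.mem_Ioi]; linarith) (by linarith [hu.2])) (hl u hu.1))
      (fun u hu => (hh u hu.1).trans (hq.anti hκT (by simp only [Set.mem_Ioi]; linarith [hu.1])
        (by linarith [hu.1])))
    rw [sub_zero, sub_self, hr.primitive_zero, sub_zero] at h
    rw [le_div_iff₀ hd]
    refine le_trans (le_of_eq ?_) h
    have := hq.pos t hT
    field_simp
  · filter_upwards [hsmall] with ε ⟨hε, hεκ, hε1⟩
    have hpos : 0 < 1 + κ + -2 * ε := by linarith
    have hpos' : 0 < κ - ε := by linarith
    refine ⟨fun t => (q ((κ - ε) * t) / q t) * (1 - R (ε * t) / R t) +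
      (q ((1 + κ + -2 * ε) * t) / q t) * (R (ε * t) / R t), ?_, ?_⟩
    · have := ((hq.ratio _ hpos').mul ((hr.slow_of_zero hε).const_sub 1)).add
        ((hq.ratio _ hpos).mul (hr.slow_of_zero hε))
      simpa using this
    filter_upwards [hmeas, hlo ε hε, hhi ε hε (by linarith),
      eventually_gt_atTop 0, eventually_gt_atTop T,
      (tendsto_id.const_mul_atTop hpos').eventually_gt_atTop T]
      with t hm hl hh ht hT hκT
    simp only [id] at hκT
    have hd : 0 < q t * R t := mul_pos (hq.pos t hT) (hr.primitive_pos ht)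
    have hκt : 0 < κ * t := by positivity
    have hεt : 0 < ε * t := by positivity
    have hε1t : ε * t < 1 / 2 * t := by gcongr
    have hlow : ∀ u ∈ Set.Ioo 0 t, q ((1 + κ + ε) * t) ≤ p t u := fun u hu =>
      le_trans (hq.anti (by simp only [Set.mem_Ioi]; linarith [hu.1])
        (by simp only [Set.mem_Ioi]; linarith) (by linarith [hu.2])) (hl u hu.1)
    obtain ⟨i1, -, h1⟩ := hr.integral_reflect_mul_bounds (g := p t) (x := 0) (y := (1 - ε) * t)
      (t := t) (by linarith) (by linarith) (hm 0 le_rfl _) (B := q ((κ - ε) * t))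
      (fun u hu => hlow u ⟨hu.1, by linarith [hu.2]⟩)
      (fun u hu => (hh u hu.1).trans (hq.anti hκT (by simp only [Set.mem_Ioi]; linarith [hu.1])
        (by linarith [hu.1])))
    obtain ⟨i2, -, h2⟩ := hr.integral_reflect_mul_bounds (g := p t) (x := (1 - ε) * t) (y := t)
      (t := t) (by linarith) le_rfl (hm _ (by linarith) _) (B := q ((1 + κ + -2 * ε) * t))
      (fun u hu => hlow u ⟨by linarith [hu.1], hu.2⟩)
      (fun u hu => (hh u (by linarith [hu.1])).trans
        (hq.anti (by simp only [Set.mem_Ioi]; linarith)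
          (by simp only [Set.mem_Ioi]; linarith [hu.1]) (by linarith [hu.1])))
    have e1 : t - (1 - ε) * t = ε * t := by ring
    rw [e1, sub_zero] at h1
    rw [e1, sub_self, hr.primitive_zero, sub_zero] at h2
    rw [div_le_iff₀ hd, ← intervalIntegral.integral_add_adjacent_intervals i1 i2]
    refine (add_le_add h1 h2).trans (le_of_eq ?_)
    have := hq.pos t hT
    have := hr.primitive_pos ht
    field_simp

end IsInvRegVarying

lemma tendsto_ratio_of_monotoneOn {f : ℝ → ℝ} {ρ c : ℝ} {m : ℝ → ℝ} (hc : 0 < c)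
    (hf : MonotoneOn f (Set.Ici 1)) (hpos : ∀ᶠ x in atTop, 0 < f x)
    (hrv : ∀ k > 0, Tendsto (fun x => f (k * x) / f x) atTop (𝓝 (k ^ ρ)))
    (hm1 : ∀ᶠ x in atTop, 1 ≤ m x) (hm : Tendsto (fun x => m x / x) atTop (𝓝 c)) :
    Tendsto (fun x => f (m x) / f x) atTop (𝓝 (c ^ ρ)) := by
  have hlim : ∀ k : ℝ, Tendsto (fun ε : ℝ => (c + k * ε) ^ ρ) (𝓝[>] 0) (𝓝 (c ^ ρ)) := by
    intro k
    have : ContinuousAt (fun ε : ℝ => (c + k * ε) ^ ρ) 0 :=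
      (by fun_prop : ContinuousAt (fun ε : ℝ => c + k * ε) 0).rpow_const (by simp [hc.ne'])
    simpa using this.tendsto.mono_left (nhdsWithin_le_nhds (s := Set.Ioi 0))
  have hsmall : ∀ᶠ ε in 𝓝[>] (0 : ℝ), 0 < ε ∧ ε < c :=
    eventually_mem_nhdsWithin.and (mem_nhdsWithin_of_mem_nhds (eventually_lt_nhds hc))
  refine tendsto_of_approx_bounds (hlim (-1)) (hlim 1) ?_ ?_
  · filter_upwards [hsmall] with ε ⟨hε, hεc⟩
    have hk : 0 < c + -1 * ε := by linarith
    refine ⟨_, hrv _ hk, ?_⟩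
    filter_upwards [hpos, hm1, hm.eventually_const_lt (show c + -1 * ε < c by linarith),
      eventually_gt_atTop 0, (tendsto_id.const_mul_atTop hk).eventually_ge_atTop 1]
      with x h1 h2 h3 h4 h5
    rw [lt_div_iff₀ h4] at h3
    exact div_le_div_of_nonneg_right (hf h5 h2 h3.le) h1.le
  · filter_upwards [hsmall] with ε ⟨hε, hεc⟩
    have hk : 0 < c + 1 * ε := by linarith
    refine ⟨_, hrv _ hk, ?_⟩
    filter_upwards [hpos, hm1, hm.eventually_lt_const (show c < c + 1 * ε by linarith),
      eventually_gt_atTop 0, (tendsto_id.const_mul_atTop hk).eventually_ge_atTop 1]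
      with x h1 h2 h3 h4 h5
    rw [div_lt_iff₀ h4] at h3
    exact div_le_div_of_nonneg_right (hf h2 h5 h3.le) h1.le

lemma le_inverse_of_le {V W : ℝ → ℝ} (hVmono : MonotoneOn V (Set.Ici 1))
    (hWmem : ∀ y ∈ Set.Ici (0 : ℝ), W y ∈ Set.Ici (1 : ℝ))
    (hVW : ∀ y ∈ Set.Ici (0 : ℝ), V (W y) = y) (hWV : ∀ x ∈ Set.Ici (1 : ℝ), W (V x) = x)
    {x y : ℝ} (hx : 1 ≤ x) (hy : 0 ≤ y) (h : V x ≤ y) : x ≤ W y := by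
  by_contra! hlt
  have h1 := hVmono (hWmem y hy) hx hlt.le
  rw [hVW y hy] at h1
  have h2 := hWV x hx
  rw [le_antisymm h h1] at h2
  exact hlt.ne h2

lemma inverse_le_of_le {V W : ℝ → ℝ} (hVmono : MonotoneOn V (Set.Ici 1))
    (hWmem : ∀ y ∈ Set.Ici (0 : ℝ), W y ∈ Set.Ici (1 : ℝ))
    (hVW : ∀ y ∈ Set.Ici (0 : ℝ), V (W y) = y) (hWV : ∀ x ∈ Set.Ici (1 : ℝ), W (V x) = x)
    {x y : ℝ} (hx : 1 ≤ x) (hy : 0 ≤ y) (h : y ≤ V x) : W y ≤ x := by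
  by_contra! hlt
  have h1 := hVmono hx (hWmem y hy) hlt.le
  rw [hVW y hy] at h1
  have h2 := hWV x hx
  rw [le_antisymm h1 h] at h2
  exact hlt.ne h2.symm

/-- If `V` and `Ψ` are regularly varying of the same index, `Ψ ∘ V⁻¹` has index `1`. -/
lemma tendsto_comp_inverse_ratio {V W Ψ : ℝ → ℝ} {γ c : ℝ} (hγ : 0 < γ) (hc : 0 < c)
    (hVmono : MonotoneOn V (Set.Ici 1))
    (hWmem : ∀ y ∈ Set.Ici (0 : ℝ), W y ∈ Set.Ici (1 : ℝ))
    (hVW : ∀ y ∈ Set.Ici (0 : ℝ), V (W y) = y) (hWV : ∀ x ∈ Set.Ici (1 : ℝ), W (V x) = x)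
    (hWtop : Tendsto W atTop atTop)
    (hΨmono : MonotoneOn Ψ (Set.Ici 1)) (hΨtop : Tendsto Ψ atTop atTop)
    (hVrv : ∀ k > 0, Tendsto (fun x => V (k * x) / V x) atTop (𝓝 (k ^ γ)))
    (hΨrv : ∀ k > 0, Tendsto (fun x => Ψ (k * x) / Ψ x) atTop (𝓝 (k ^ γ))) :
    Tendsto (fun y => Ψ (W (c * y)) / Ψ (W y)) atTop (𝓝 c) := by
  have hlim : ∀ k : ℝ, Tendsto (fun ε : ℝ => c + k * ε) (𝓝[>] 0) (𝓝 c) := by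
    intro k
    have : ContinuousAt (fun ε : ℝ => c + k * ε) 0 := by fun_prop
    simpa using this.tendsto.mono_left (nhdsWithin_le_nhds (s := Set.Ioi 0))
  have hsmall : ∀ᶠ ε in 𝓝[>] (0 : ℝ), 0 < ε ∧ ε < c :=
    eventually_mem_nhdsWithin.and (mem_nhdsWithin_of_mem_nhds (eventually_lt_nhds hc))
  have key : ∀ b > 0, ∃ k : ℝ, 0 < k ∧
      Tendsto (fun y => V (k * W y) / y) atTop (𝓝 b) ∧
      Tendsto (fun y => Ψ (k * W y) / Ψ (W y)) atTop (𝓝 b) ∧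
      ∀ᶠ y in atTop, 0 < y ∧ 1 ≤ k * W y ∧ 0 < Ψ (W y) := by
    intro b hb
    have hk : 0 < b ^ γ⁻¹ := Real.rpow_pos_of_pos hb _
    have hkγ : (b ^ γ⁻¹) ^ γ = b := Real.rpow_inv_rpow hb.le hγ.ne'
    refine ⟨b ^ γ⁻¹, hk, ?_, ?_, ?_⟩
    · have := (hVrv _ hk).comp hWtop
      rw [hkγ] at this
      refine this.congr' ?_
      filter_upwards [eventually_ge_atTop 0] with y hy
      simp only [Function.comp, hVW y hy]
    · have := (hΨrv _ hk).comp hWtop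
      rwa [hkγ] at this
    · filter_upwards [eventually_gt_atTop 0,
        (hWtop.const_mul_atTop hk).eventually_ge_atTop 1,
        (hΨtop.comp hWtop).eventually_gt_atTop 0] with y h1 h2 h3 using ⟨h1, h2, h3⟩
  refine tendsto_of_approx_bounds (hlim (-1)) (hlim 1) ?_ ?_
  · filter_upwards [hsmall] with ε ⟨hε, hεc⟩
    obtain ⟨k, hk, hV, hΨ, hev⟩ := key (c + -1 * ε) (by linarith)
    refine ⟨_, hΨ, ?_⟩
    filter_upwards [hev, hV.eventually_lt_const (show c + -1 * ε < c by linarith)]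
      with y ⟨hy, h1, h2⟩ h3
    rw [div_lt_iff₀ hy] at h3
    have hcy : 0 ≤ c * y := by positivity
    exact div_le_div_of_nonneg_right (hΨmono h1 (hWmem _ hcy)
      (le_inverse_of_le hVmono hWmem hVW hWV h1 hcy h3.le)) h2.le
  · filter_upwards [hsmall] with ε ⟨hε, hεc⟩
    obtain ⟨k, hk, hV, hΨ, hev⟩ := key (c + 1 * ε) (by linarith)
    refine ⟨_, hΨ, ?_⟩
    filter_upwards [hev, hV.eventually_const_lt (show c < c + 1 * ε by linarith)]
      with y ⟨hy, h1, h2⟩ h3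
    rw [lt_div_iff₀ hy] at h3
    have hcy : 0 ≤ c * y := by positivity
    exact div_le_div_of_nonneg_right (hΨmono (hWmem _ hcy) h1
      (inverse_le_of_le hVmono hWmem hVW hWV h1 hcy h3.le)) h2.le

lemma tendsto_one_sub_exp_neg_div :
    Tendsto (fun x : ℝ => (1 - Real.exp (-x)) / x) (𝓝[≠] 0) (𝓝 1) := by
  have h : HasDerivAt (fun x : ℝ => 1 - Real.exp (-x)) 1 0 := by
    have := ((hasDerivAt_id (0 : ℝ)).neg.exp).const_sub 1
    simpa using this
  have := h.tendsto_slope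
  refine this.congr fun x => ?_
  simp [slope_def_field]

lemma tendsto_one_sub_exp_neg_ratio {A B D : ℝ → ℝ} {a b : ℝ} (ha : 0 < a) (hb : 0 < b)
    (hD : Tendsto D atTop (𝓝 0)) (hDpos : ∀ᶠ t in atTop, 0 < D t)
    (hA : Tendsto (fun t => A t / D t) atTop (𝓝 a))
    (hB : Tendsto (fun t => B t / D t) atTop (𝓝 b)) :
    Tendsto (fun t => (1 - Real.exp (-A t)) / (1 - Real.exp (-B t))) atTop (𝓝 (a / b)) := by
  have key : ∀ {C : ℝ → ℝ} {c : ℝ}, 0 < c → Tendsto (fun t => C t / D t) atTop (𝓝 c) →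
      Tendsto (fun t => (1 - Real.exp (-C t)) / D t) atTop (𝓝 c) := by
    intro C c hc hC
    have hCpos : ∀ᶠ t in atTop, C t ≠ 0 := by
      filter_upwards [hC.eventually_const_lt hc, hDpos] with t h1 h2
      rintro h
      simp [h] at h1
    have hC0 : Tendsto C atTop (𝓝[≠] 0) := by
      refine tendsto_nhdsWithin_iff.2 ⟨?_, hCpos⟩
      have := hC.mul hD
      rw [mul_zero] at this
      refine this.congr' ?_
      filter_upwards [hDpos] with t ht using div_mul_cancel₀ _ ht.ne'
    have := (tendsto_one_sub_exp_neg_div.comp hC0).mul hC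
    rw [one_mul] at this
    refine this.congr' ?_
    filter_upwards [hCpos] with t ht
    exact div_mul_div_cancel₀ ht
  refine ((key ha hA).div (key hb hB) hb.ne').congr' ?_
  filter_upwards [hDpos] with t ht
  exact div_div_div_cancel_right₀ ht.ne' _ _

lemma tendsto_inv_one_sub_exp_neg_div {lam : ℝ} (hlam : 0 < lam) :
    Tendsto (fun x : ℝ => 1 / (1 - Real.exp (-(lam / x))) / x) atTop (𝓝 lam⁻¹) := by
  have h1 : Tendsto (fun x : ℝ => lam / x) atTop (𝓝[≠] 0) := by
    refine tendsto_nhdsWithin_iff.2 ⟨tendsto_const_nhds.div_atTop tendsto_id, ?_⟩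
    filter_upwards [eventually_gt_atTop 0] with x hx
    exact (div_pos hlam hx).ne'
  have := ((tendsto_one_sub_exp_neg_div.comp h1).inv₀ one_ne_zero).mul_const lam⁻¹
  rw [inv_one, one_mul] at this
  refine this.congr' ?_
  filter_upwards [eventually_gt_atTop 0] with x hx
  simp only [Function.comp, inv_div]
  field_simp

end

open Filter MeasureTheory Real in
theorem stmt15
    (μ γ α : ℝ) (hμ : 0 < μ) (hγ : γ ∈ Set.Ioc (0:ℝ) 1) (hα : α ∈ Set.Ioc (0:ℝ) 1)
    (L l : ℝ → ℝ)
    (hLpos : ∀ x ∈ Set.Ici (1:ℝ), 0 < L x)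
    (hLcont : ContinuousOn L (Set.Ici 1))
    (hLsv : ∀ c > (0:ℝ), Filter.Tendsto (fun t => L (c * t) / L t) Filter.atTop (nhds 1))
    (hlsv : ∀ c > (0:ℝ), Filter.Tendsto (fun t => l (c * t) / l t) Filter.atTop (nhds 1))
    (V W : ℝ → ℝ)
    (hV : ∀ x ∈ Set.Ici (1:ℝ), V x = ∫ u in (1:ℝ)..x, u ^ (γ - 1) / L u)
    (hVtop : Filter.Tendsto V Filter.atTop Filter.atTop)
    (hWmem : ∀ y ∈ Set.Ici (0:ℝ), W y ∈ Set.Ici (1:ℝ))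
    (hVW : ∀ y ∈ Set.Ici (0:ℝ), V (W y) = y)
    (hWV : ∀ x ∈ Set.Ici (1:ℝ), W (V x) = x)
    (Ψ : ℝ → ℝ)
    (hΨ : ∀ x ∈ Set.Ici (1:ℝ), Ψ x = x ^ α / l x)
    (hΨmono : MonotoneOn Ψ (Set.Ici 1))
    (hΨtop : Filter.Tendsto Ψ Filter.atTop Filter.atTop)
    (q : ℝ → ℝ → ℝ)
    (hq : ∀ t ∈ Set.Ici (0:ℝ), ∀ s ∈ Set.Ico (0:ℝ) 1,
      q t s = 1 / Ψ (W (μ * t + V (1 / (1 - s)))))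
    (θ : ℝ) (hθpos : 0 < θ)
    (r : ℝ → ℝ)
    (hrpos : ∀ t > (0:ℝ), 0 < r t)
    (hranti : AntitoneOn r (Set.Ioi 0))
    (hrint : ∀ t > (0:ℝ), MeasureTheory.IntegrableOn r (Set.Ioc 0 t))
    (hrrv : ∀ c > (0:ℝ), Filter.Tendsto (fun t => r (c * t) / r t) Filter.atTop (nhds (c ^ (-θ))))
    (R Q : ℝ → ℝ)
    (hR : ∀ t, R t = ∫ u in (0:ℝ)..t, r u)
    (hQ : ∀ t, Q t = ∫ u in (0:ℝ)..t, q u 0)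
    (I : ℝ → ℝ → ℝ) (hI : ∀ t s, I t s = ∫ u in (0:ℝ)..t, r (t - u) * q u s)
    (Φ : ℝ → ℝ → ℝ) (hΦ : ∀ t s, Φ t s = Real.exp (-(I t s)))
    (hθ : θ = 1) (hαγ : α = γ)
    (hRmono : MonotoneOn R (Set.Ici 0))
    (hQtop : Filter.Tendsto Q Filter.atTop Filter.atTop)
    (d : ℝ) (hd : 0 ≤ d)
    (hlim : Filter.Tendsto (fun t => r t * Q t / (q t 0 * R t)) Filter.atTop (nhds d))
    (lam : ℝ) (hlam : 0 < lam) :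
    Filter.Tendsto
      (fun t => (1 - Φ t (Real.exp (-(lam / W (μ * t))))) / (1 - Φ t 0))
      Filter.atTop (nhds ((1 + lam ^ (-γ))⁻¹ / (1 + d))) := by
  subst hθ hαγ
  have hγ0 : 0 < α := hα.1
  have hfpos : ∀ u ≥ (1 : ℝ), 0 < u ^ (α - 1) / L u := fun u hu =>
    div_pos (Real.rpow_pos_of_pos (by linarith) _) (hLpos u hu)
  have hfint : ∀ x ≥ (1 : ℝ), ∀ y ≥ (1 : ℝ),
      IntervalIntegrable (fun u => u ^ (α - 1) / L u) volume x y := by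
    intro x hx y hy
    refine ContinuousOn.intervalIntegrable fun u hu => ?_
    have hu1 : (1 : ℝ) ≤ u := (le_min hx hy).trans hu.1
    refine ContinuousWithinAt.div ?_ ((hLcont u hu1).mono fun v hv => (le_min hx hy).trans hv.1)
      (hLpos u hu1).ne'
    exact (Real.continuousAt_rpow_const u _ (Or.inl (by linarith))).continuousWithinAt
  have hVsub : ∀ x ≥ (1 : ℝ), ∀ y ≥ (1 : ℝ), V y - V x = ∫ u in x..y, u ^ (α - 1) / L u := by
    intro x hx y hy
    rw [hV x hx, hV y hy, intervalIntegral.integral_interval_sub_left (hfint 1 le_rfl y hy)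
      (hfint 1 le_rfl x hx)]
  have hVmono : MonotoneOn V (Set.Ici 1) := by
    intro x hx y hy hxy
    rw [← sub_nonneg, hVsub x hx y hy]
    exact intervalIntegral.integral_nonneg hxy fun u hu => (hfpos u (le_trans hx hu.1)).le
  have hV1 : V 1 = 0 := by rw [hV 1 (Set.mem_Ici.2 le_rfl), intervalIntegral.integral_same]
  have hV0 : ∀ x ≥ (1 : ℝ), 0 ≤ V x := fun x hx =>
    hV1 ▸ hVmono (Set.mem_Ici.2 le_rfl) hx hx
  have hVrv : ∀ k > 0, Tendsto (fun x => V (k * x) / V x) atTop (nhds (k ^ α)) := by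
    intro k hk
    refine tendsto_primitive_ratio (f := fun u => u ^ (α - 1) / L u) (T := 1) hk
      (fun x hx y hy => hVsub x hx.le y (hx.le.trans hy))
      (fun x hx y hy => hfint x hx.le y (hx.le.trans hy)) (fun u hu => hfpos u hu.le) ?_ hVtop
    have h := ((hLsv k hk).inv₀ one_ne_zero).const_mul (k ^ α)
    rw [inv_one, mul_one] at h
    refine h.congr' ?_
    filter_upwards [eventually_ge_atTop 1, (tendsto_id.const_mul_atTop hk).eventually_ge_atTop 1]
      with u hu hku
    have h1 := hLpos u hu
    have h2 := hLpos (k * u) hku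
    have h3 : 0 < u ^ (α - 1) := Real.rpow_pos_of_pos (by linarith) _
    rw [Real.mul_rpow hk.le (by linarith), Real.rpow_sub_one hk.ne']
    field_simp
  have hΨrv : ∀ k > 0, Tendsto (fun x => Ψ (k * x) / Ψ x) atTop (nhds (k ^ α)) := by
    intro k hk
    have h := ((hlsv k hk).inv₀ one_ne_zero).const_mul (k ^ α)
    rw [inv_one, mul_one] at h
    refine h.congr' ?_
    filter_upwards [eventually_ge_atTop 1, (tendsto_id.const_mul_atTop hk).eventually_ge_atTop 1]
      with u hu hku
    have h3 : 0 < u ^ α := Real.rpow_pos_of_pos (by linarith) _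
    rw [hΨ u hu, hΨ (k * u) hku, Real.mul_rpow hk.le (by linarith), inv_div, div_div_div_eq,
      mul_comm (l (k * u)), mul_assoc, mul_div_assoc, mul_div_mul_left _ _ h3.ne']
  have hWmono : MonotoneOn W (Set.Ici 0) := fun y hy z hz hyz =>
    le_inverse_of_le hVmono hWmem hVW hWV (hWmem y hy) hz ((hVW y hy).trans_le hyz)
  have hWtop : Tendsto W atTop atTop := by
    refine tendsto_atTop.2 fun b => ?_
    filter_upwards [eventually_ge_atTop (V (max 1 b))] with y hy
    have h1 : (1 : ℝ) ≤ max 1 b := le_max_left _ _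
    exact (le_max_right _ _).trans
      (le_inverse_of_le hVmono hWmem hVW hWV h1 ((hV0 _ h1).trans hy) hy)
  have hG : ∀ c > 0, Tendsto (fun y => Ψ (W (c * y)) / Ψ (W y)) atTop (nhds c) := fun c hc =>
    tendsto_comp_inverse_ratio hγ0 hc hVmono hWmem hVW hWV hWtop hΨmono hΨtop hVrv hΨrv
  have hGmono : MonotoneOn (fun y => Ψ (W y)) (Set.Ici 0) := fun y hy z hz hyz =>
    hΨmono (hWmem y hy) (hWmem z hz) (hWmono hy hz hyz)
  have hμtop : Tendsto (fun t : ℝ => μ * t) atTop atTop := tendsto_id.const_mul_atTop hμ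
  have hq0 : ∀ t ≥ 0, q t 0 = 1 / Ψ (W (μ * t)) := by
    intro t ht
    rw [hq t ht 0 (by simp), sub_zero, div_one, hV1, add_zero]
  obtain ⟨T, hT⟩ := eventually_atTop.1 ((eventually_ge_atTop (0 : ℝ)).and
    (((hΨtop.comp hWtop).comp hμtop).eventually_gt_atTop 0))
  have hT0 : 0 ≤ T := (hT T le_rfl).1
  have hΨpos : ∀ t ≥ T, 0 < Ψ (W (μ * t)) := fun t ht => (hT t ht).2
  have hQV : IsInvRegVarying T (fun t => q t 0) Q := by
    refine ⟨hT0, fun t ht => ?_, fun x hx y hy hxy => ?_, fun t ht => ?_, hQ, fun c hc => ?_⟩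
    · rw [hq0 t (hT0.trans ht.le)]
      exact one_div_pos.2 (hΨpos t ht.le)
    · have hx0 : 0 ≤ x := hT0.trans (le_of_lt hx)
      have hy0 : 0 ≤ y := hT0.trans (le_of_lt hy)
      simp only [hq0 x hx0, hq0 y hy0]
      exact one_div_le_one_div_of_le (hΨpos x (le_of_lt hx))
        (hGmono (by simp; positivity) (by simp; positivity) (by gcongr))
    · by_contra hni
      obtain ⟨S, hS⟩ := ((hQtop.eventually_gt_atTop 0).and (eventually_ge_atTop t)).exists
      rw [hQ, intervalIntegral.integral_undef] at hS
      · exact lt_irrefl _ hS.1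
      · exact fun h => hni (h.mono_set (by
          rw [Set.uIcc_of_le ht, Set.uIcc_of_le (ht.trans hS.2)]
          exact Set.Icc_subset_Icc_right hS.2))
    · refine (((hG c hc).comp hμtop).inv₀ hc.ne').congr' ?_
      filter_upwards [eventually_ge_atTop 0] with t ht
      simp only [hq0 t ht, hq0 (c * t) (by positivity), Function.comp, mul_left_comm c μ t,
        one_div, inv_div, inv_div_inv]
  have hRV : IsInvRegVarying 0 r R := by
    refine ⟨le_rfl, hrpos, hranti, fun t ht => ?_, hR, fun c hc => ?_⟩
    · rcases ht.eq_or_lt with rfl | h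
      · exact IntervalIntegrable.refl
      · exact (intervalIntegrable_iff_integrableOn_Ioc_of_le h.le).2 (hrint t h)
    · simpa [Real.rpow_neg_one] using hrrv c hc
  set m : ℝ → ℝ := fun x => 1 / (1 - Real.exp (-(lam / x))) with hm
  have hs : ∀ x ≥ (1 : ℝ), Real.exp (-(lam / x)) ∈ Set.Ico (0 : ℝ) 1 := fun x hx =>
    ⟨(Real.exp_pos _).le, Real.exp_lt_one_iff.2 (neg_neg_of_pos (div_pos hlam (by linarith)))⟩
  have hm1 : ∀ x ≥ (1 : ℝ), 1 ≤ m x := by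
    intro x hx
    obtain ⟨h1, h2⟩ := hs x hx
    exact (one_le_div (by linarith)).2 (by linarith)
  set v : ℝ → ℝ := fun t => V (m (W (μ * t))) with hv
  have hvlim : Tendsto (fun t => v t / (μ * t)) atTop (nhds (lam ^ (-α))) := by
    have h := ((tendsto_ratio_of_monotoneOn (inv_pos.2 hlam) hVmono (hVtop.eventually_gt_atTop 0)
      hVrv ((eventually_ge_atTop 1).mono hm1)
      (tendsto_inv_one_sub_exp_neg_div hlam)).comp hWtop).comp hμtop
    rw [Real.inv_rpow hlam.le, ← Real.rpow_neg hlam.le] at h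
    refine h.congr' ?_
    filter_upwards [eventually_ge_atTop 0] with t ht
    simp only [Function.comp, hVW (μ * t) (Set.mem_Ici.2 (by positivity)), hv]
  have hκ : 0 < lam ^ (-α) := Real.rpow_pos_of_pos hlam _
  have hW1 : ∀ t ≥ 0, 1 ≤ W (μ * t) := fun t ht => hWmem _ (Set.mem_Ici.2 (by positivity))
  have hp : ∀ t ≥ 0, ∀ u ≥ 0,
      q u (Real.exp (-(lam / W (μ * t)))) = 1 / Ψ (W (μ * u + v t)) := fun t ht u hu =>
    hq u hu _ (hs _ (hW1 t ht))
  have hv0 : ∀ t ≥ 0, 0 ≤ v t := fun t ht => hV0 _ (hm1 _ (hW1 t ht))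
  have hlower : ∀ k < lam ^ (-α), ∀ᶠ t in atTop, k * t * μ ≤ v t := by
    intro k hk
    filter_upwards [hvlim.eventually_const_lt hk, eventually_gt_atTop 0] with t h1 h2
    rw [lt_div_iff₀ (by positivity)] at h1
    linarith
  have hupper : ∀ k > lam ^ (-α), ∀ᶠ t in atTop, v t ≤ k * t * μ := by
    intro k hk
    filter_upwards [hvlim.eventually_lt_const hk, eventually_gt_atTop 0] with t h1 h2
    rw [div_lt_iff₀ (by positivity)] at h1
    linarith
  have hΨv : ∀ᶠ t in atTop, 0 < Ψ (W (v t)) := by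
    filter_upwards [hlower (lam ^ (-α) / 2) (by linarith), eventually_ge_atTop 0,
      (tendsto_id.const_mul_atTop (half_pos hκ)).eventually_ge_atTop T] with t h1 h2 h3
    simp only [id] at h3
    have h4 := hΨpos _ h3
    rw [mul_comm μ] at h4
    exact h4.trans_le (hGmono (by simp; positivity) (hv0 t h2) h1)
  have hI0 := hRV.convolution_asymptotics hQV hQtop hlim
  have hI1 := hRV.shifted_convolution_asymptotics hQV hκ
    (p := fun t u => q u (Real.exp (-(lam / W (μ * t))))) ?_ ?_ ?_
  · have hD : ∀ᶠ t in atTop, 0 < q t 0 * R t := by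
      filter_upwards [eventually_gt_atTop T] with t ht
      exact mul_pos (hQV.pos t ht) (hRV.primitive_pos (hT0.trans_lt ht))
    have h := tendsto_one_sub_exp_neg_ratio (by positivity) (by positivity)
      (hRV.tendsto_mul_zero hQV) hD hI1 hI0
    simpa only [hΦ, hI] using h
  · filter_upwards [hΨv, eventually_ge_atTop 0] with t h1 ht x hx y hy hxy
    have hx0 : 0 ≤ x := le_of_lt hx
    have hy0 : 0 ≤ y := le_of_lt hy
    have hvt := hv0 t ht
    simp only [hp t ht x hx0, hp t ht y hy0]
    have h2 : Ψ (W (v t)) ≤ Ψ (W (μ * x + v t)) :=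
      hGmono hvt (by simp; positivity) (le_add_of_nonneg_left (by positivity))
    exact one_div_le_one_div_of_le (h1.trans_le h2)
      (hGmono (by simp; positivity) (by simp; positivity) (by gcongr))
  · intro ε hε
    filter_upwards [hΨv, eventually_ge_atTop 0, hupper (lam ^ (-α) + ε) (by linarith)]
      with t h1 ht h3 u hu
    have hvt := hv0 t ht
    rw [hp t ht u hu.le, hq0 _ (by positivity)]
    have h2 : Ψ (W (v t)) ≤ Ψ (W (μ * u + v t)) :=
      hGmono hvt (by simp; positivity) (le_add_of_nonneg_left (by positivity))
    exact one_div_le_one_div_of_le (h1.trans_le h2)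
      (hGmono (by simp; positivity) (by simp; positivity) (by linarith))
  · intro ε hε hεκ
    filter_upwards [hlower (lam ^ (-α) - ε) (by linarith), eventually_ge_atTop 0,
      (tendsto_id.const_mul_atTop (sub_pos.2 hεκ)).eventually_ge_atTop T] with t h1 ht h3 u hu
    simp only [id] at h3
    have hvt := hv0 t ht
    have hnn : 0 ≤ u + (lam ^ (-α) - ε) * t := by linarith
    rw [hp t ht u hu.le, hq0 _ hnn]
    exact one_div_le_one_div_of_le (hΨpos _ (by linarith))
      (hGmono (by simp; positivity) (by simp; positivity) (by linarith))
end

section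
/- Assume 0 < θ < 1, 0 < α/γ < 1, and t·r(t)·q(t) → ∞ as t → ∞. Let Ψ⁻¹ denote the (non-decreasing) inverse of Ψ. Then for every λ > 0, taking s(t) = exp(−λ/Ψ⁻¹(R(t))), one has I(t; s(t)) → λ^α as t → ∞, and consequently Φ(t; s(t)) → exp(−λ^α); equivalently, the (unconditional) Laplace transform E[exp(−λ Y(t)/Ψ⁻¹(R(t)))] converges to exp(−λ^α), the Laplace transform of a stable law with parameter α. -/
section

open Filter MeasureTheory Real

/-- A function that is monotone on `[1, ∞)` and regularly varying at infinity respects asymptotic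
proportionality of its arguments. -/
theorem tendsto_div_of_regularlyVarying {ι : Type*} {F : Filter ι} {f : ℝ → ℝ} {ρ : ℝ}
    (hmono : MonotoneOn f (Set.Ici 1)) (htop : Tendsto f atTop atTop)
    (hrv : ∀ c > (0 : ℝ), Tendsto (fun t => f (c * t) / f t) atTop (nhds (c ^ ρ)))
    {a b : ι → ℝ} {c : ℝ} (hc : 0 < c) (hb : Tendsto b F atTop)
    (hab : Tendsto (fun i => a i / b i) F (nhds c)) :
    Tendsto (fun i => f (a i) / f (b i)) F (nhds (c ^ ρ)) := by
  have ha : Tendsto a F atTop := by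
    refine (hab.pos_mul_atTop hc hb).congr' ?_
    filter_upwards [hb.eventually_gt_atTop 0] with i hi
    field_simp
  have hcont : ContinuousAt (fun x : ℝ => x ^ ρ) c := continuousAt_rpow_const c ρ (Or.inl hc.ne')
  rw [tendsto_order]
  constructor
  · intro m hm
    have h1 : ∀ᶠ x in nhds c, m < x ^ ρ := hcont.eventually (lt_mem_nhds hm)
    obtain ⟨d, ⟨hmd, hd0⟩, hdc⟩ := ((h1.and (lt_mem_nhds hc)).filter_mono
      (nhdsWithin_le_nhds (s := Set.Iio c)) |>.and self_mem_nhdsWithin).exists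
    filter_upwards [hab.eventually (lt_mem_nhds hdc), hb.eventually_gt_atTop 0,
      hb.eventually (htop.eventually_gt_atTop 0), ha.eventually_ge_atTop 1,
      (hb.const_mul_atTop hd0).eventually_ge_atTop 1,
      ((hrv d hd0).comp hb).eventually (lt_mem_nhds hmd)] with i h2 h3 h4 h5 h6 h7
    refine h7.trans_le (div_le_div_of_nonneg_right (hmono h6 h5 ?_) h4.le)
    exact ((lt_div_iff₀ h3).1 h2).le
  · intro m hm
    have h1 : ∀ᶠ x in nhds c, x ^ ρ < m := hcont.eventually (gt_mem_nhds hm)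
    obtain ⟨d, ⟨hmd, hd0⟩, hdc⟩ := ((h1.and (lt_mem_nhds hc)).filter_mono
      (nhdsWithin_le_nhds (s := Set.Ioi c)) |>.and self_mem_nhdsWithin).exists
    filter_upwards [hab.eventually (gt_mem_nhds hdc), hb.eventually_gt_atTop 0,
      hb.eventually (htop.eventually_gt_atTop 0), ha.eventually_ge_atTop 1,
      (hb.const_mul_atTop hd0).eventually_ge_atTop 1,
      ((hrv d hd0).comp hb).eventually (gt_mem_nhds hmd)] with i h2 h3 h4 h5 h6 h7
    refine (div_le_div_of_nonneg_right (hmono h5 h6 ?_) h4.le).trans_lt h7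
    exact ((div_lt_iff₀ h3).1 h2).le

theorem tendsto_rpow_div_slowlyVarying {α : ℝ} {l Ψ : ℝ → ℝ}
    (hlsv : ∀ c > (0 : ℝ), Tendsto (fun t => l (c * t) / l t) atTop (nhds 1))
    (hΨ : ∀ x ∈ Set.Ici (1 : ℝ), Ψ x = x ^ α / l x) (c : ℝ) (hc : 0 < c) :
    Tendsto (fun t => Ψ (c * t) / Ψ t) atTop (nhds (c ^ α)) := by
  have h := ((hlsv c hc).inv₀ one_ne_zero).const_mul (c ^ α)
  rw [inv_one, mul_one] at h
  refine h.congr' ?_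
  filter_upwards [eventually_ge_atTop 1,
    (tendsto_id.const_mul_atTop hc).eventually_ge_atTop 1] with t ht hct
  have hct' : (1 : ℝ) ≤ c * t := hct
  have ht0 : (0 : ℝ) < t := by linarith
  have h1 : t ^ α ≠ 0 := (rpow_pos_of_pos ht0 α).ne'
  rw [hΨ t ht, hΨ _ hct', mul_rpow hc.le ht0.le, inv_div, div_div_div_eq,
    show c ^ α * t ^ α * l t = t ^ α * (c ^ α * l t) by ring, mul_comm (l (c * t)),
    mul_div_mul_left _ _ h1, mul_div_assoc]

/-- A divergent integral of a positive, regularly varying function of index greater than `-1` grows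
at least by a fixed factor when its argument is dilated. -/
theorem exists_mul_integral_le_integral_dilate {γ : ℝ} (hγ : 0 < γ) {L V : ℝ → ℝ}
    (hLpos : ∀ x ∈ Set.Ici (1 : ℝ), 0 < L x) (hLcont : ContinuousOn L (Set.Ici 1))
    (hLsv : ∀ c > (0 : ℝ), Tendsto (fun t => L (c * t) / L t) atTop (nhds 1))
    (hV : ∀ x ∈ Set.Ici (1 : ℝ), V x = ∫ u in (1 : ℝ)..x, u ^ (γ - 1) / L u)
    (hVtop : Tendsto V atTop atTop) {c : ℝ} (hc : 1 < c) :
    ∃ k > (1 : ℝ), ∀ᶠ x in atTop, k * V x ≤ V (c * x) := by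
  have hc0 : 0 < c := by linarith
  set g : ℝ → ℝ := fun u => u ^ (γ - 1) / L u with hg
  have hgc : ContinuousOn g (Set.Ici 1) := by
    refine ContinuousOn.div ?_ hLcont fun x hx => (hLpos x hx).ne'
    exact continuousOn_id.rpow_const fun x hx => Or.inl (zero_lt_one.trans_le hx).ne'
  have hgi : ∀ a ∈ Set.Ici (1 : ℝ), ∀ b ∈ Set.Ici (1 : ℝ), IntervalIntegrable g volume a b := by
    intro a ha b hb
    refine (hgc.mono fun x hx => ?_).intervalIntegrable
    exact (le_min ha hb).trans hx.1
  have hVsub : ∀ a ∈ Set.Ici (1 : ℝ), ∀ b ∈ Set.Ici (1 : ℝ), V b - V a = ∫ u in a..b, g u := by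
    intro a ha b hb
    have h1 : (1 : ℝ) ∈ Set.Ici (1 : ℝ) := Set.self_mem_Ici
    rw [hV a ha, hV b hb]
    exact intervalIntegral.integral_interval_sub_left (hgi 1 h1 b hb) (hgi 1 h1 a ha)
  have hcγ : 1 < c ^ γ := one_lt_rpow hc hγ
  obtain ⟨K, hK1, hKc⟩ := exists_between hcγ
  obtain ⟨k, hk1, hkK⟩ := exists_between hK1
  refine ⟨k, hk1, ?_⟩
  have hratio : ∀ᶠ u in atTop, K * g u ≤ c * g (c * u) := by
    have h := ((hLsv c hc0).inv₀ one_ne_zero).const_mul (c ^ γ)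
    rw [inv_one, mul_one] at h
    filter_upwards [h.eventually (lt_mem_nhds hKc), eventually_ge_atTop 1] with u hu hu1
    have hu0 : 0 < u := by linarith
    have hcu : 1 ≤ c * u := by nlinarith
    have hL1 := hLpos u hu1
    have hL2 := hLpos _ hcu
    have hgu : 0 < g u := div_pos (rpow_pos_of_pos hu0 _) hL1
    have heq : c * g (c * u) = (c ^ γ * (L (c * u) / L u)⁻¹) * g u := by
      simp only [hg]
      rw [mul_rpow hc0.le hu0.le, rpow_sub_one hc0.ne']
      field_simp
    rw [heq]
    exact mul_le_mul_of_nonneg_right hu.le hgu.le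
  obtain ⟨A, hA⟩ := (hratio.and (eventually_ge_atTop 1)).exists_forall_of_atTop
  have hA1 : 1 ≤ A := (hA A le_rfl).2
  have hcA : 1 ≤ c * A := by nlinarith
  filter_upwards [eventually_ge_atTop A,
    (hVtop.const_mul_atTop (sub_pos.2 hkK)).eventually_ge_atTop (K * V A - V (c * A))]
    with x hx hVx
  have hx1 : 1 ≤ x := hA1.trans hx
  have hcx : 1 ≤ c * x := by nlinarith
  have h1 : ∫ u in A..x, K * g u ≤ ∫ u in A..x, c * g (c * u) := by
    refine intervalIntegral.integral_mono_on hx ((hgi A hA1 x hx1).const_mul K) ?_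
      fun u hu => (hA u hu.1).1
    refine ContinuousOn.intervalIntegrable ?_
    refine (hgc.comp (continuousOn_const.mul continuousOn_id) fun u hu => ?_).const_mul c
    rw [Set.uIcc_of_le hx] at hu
    have : 1 ≤ u := hA1.trans hu.1
    exact (by nlinarith : 1 ≤ c * u)
  rw [intervalIntegral.integral_const_mul, intervalIntegral.integral_const_mul,
    intervalIntegral.mul_integral_comp_mul_left, ← hVsub A hA1 x hx1, ← hVsub _ hcA _ hcx] at h1
  linarith

theorem exists_forall_mul_le_dilate {V : ℝ → ℝ} (hVtop : Tendsto V atTop atTop)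
    {c k : ℝ} (hc : 0 < c) (hk : 1 < k) (h : ∀ᶠ x in atTop, k * V x ≤ V (c * x)) (M : ℝ) :
    ∃ C > (0 : ℝ), ∀ᶠ x in atTop, M * V x ≤ V (C * x) := by
  have hpow : ∀ n : ℕ, ∀ᶠ x in atTop, k ^ n * V x ≤ V (c ^ n * x) := by
    intro n
    induction n with
    | zero => simp
    | succ n ih =>
      filter_upwards [ih, (tendsto_id.const_mul_atTop (pow_pos hc n)).eventually h] with x h1 h2
      calc k ^ (n + 1) * V x = k * (k ^ n * V x) := by ring
        _ ≤ k * V (c ^ n * x) := by gcongr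
        _ ≤ V (c * (c ^ n * x)) := h2
        _ = V (c ^ (n + 1) * x) := by ring_nf
  obtain ⟨n, hn⟩ := pow_unbounded_of_one_lt M hk
  refine ⟨c ^ n, pow_pos hc n, ?_⟩
  filter_upwards [hpow n, hVtop.eventually_ge_atTop 0] with x h1 h2
  exact (mul_le_mul_of_nonneg_right hn.le h2).trans h1

theorem tendsto_div_one_sub_exp_neg :
    Tendsto (fun h : ℝ => h / (1 - exp (-h))) (nhdsWithin 0 (Set.Ioi 0)) (nhds 1) := by
  have h1 : HasDerivAt (fun h : ℝ => 1 - exp (-h)) 1 0 := by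
    have := ((hasDerivAt_id (0 : ℝ)).neg.exp).const_sub 1
    simpa using this
  have h2 := (hasDerivAt_iff_tendsto_slope.1 h1).inv₀ one_ne_zero
  rw [inv_one] at h2
  refine (h2.mono_left (nhdsWithin_mono 0 fun x (hx : 0 < x) => hx.ne')).congr fun h => ?_
  simp [slope_def_field]

/-- Bounds for the integral of `r (t - u) * p u` when `p` is antitone. -/
theorem integral_comp_sub_mul_mem_Icc {r p : ℝ → ℝ} {t : ℝ} (ht : 0 < t)
    (hr : IntegrableOn r (Set.Ioc 0 t)) (hrpos : ∀ u > (0 : ℝ), 0 < r u)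
    (hp : AntitoneOn p (Set.Icc 0 t)) :
    ∫ u in (0 : ℝ)..t, r (t - u) * p u ∈
      Set.Icc ((∫ u in (0 : ℝ)..t, r u) * p t) ((∫ u in (0 : ℝ)..t, r u) * p 0) := by
  have hri : IntervalIntegrable r volume 0 t :=
    (intervalIntegrable_iff_integrableOn_Ioc_of_le ht.le).2 hr
  have hri' : IntervalIntegrable (fun u => r (t - u)) volume 0 t := by
    have := (hri.comp_sub_left t).symm
    simpa using this
  have hR : ∫ u in (0 : ℝ)..t, r (t - u) = ∫ u in (0 : ℝ)..t, r u := by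
    rw [intervalIntegral.integral_comp_sub_left (fun u => r u)]
    simp
  have h0 : (0 : ℝ) ∈ Set.Icc 0 t := ⟨le_rfl, ht.le⟩
  have h1 : t ∈ Set.Icc 0 t := ⟨ht.le, le_rfl⟩
  have hpi : IntervalIntegrable (fun u => r (t - u) * p u) volume 0 t := by
    rw [intervalIntegrable_iff_integrableOn_Icc_of_le ht.le] at hri' ⊢
    refine Integrable.mul_bdd (c := max |p t| |p 0|) hri' ?_ ?_
    · exact (hp.integrableOn_isCompact isCompact_Icc).aestronglyMeasurable
    · filter_upwards [ae_restrict_mem measurableSet_Icc] with u hu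
      exact abs_le_max_abs_abs (hp hu h1 hu.2) (hp h0 hu hu.1)
  rw [← hR, ← intervalIntegral.integral_mul_const, ← intervalIntegral.integral_mul_const]
  constructor
  · refine intervalIntegral.integral_mono_on_of_le_Ioo ht.le (hri'.mul_const _) hpi fun u hu => ?_
    exact mul_le_mul_of_nonneg_left (hp ⟨hu.1.le, hu.2.le⟩ h1 hu.2.le)
      (hrpos _ (sub_pos.2 hu.2)).le
  · refine intervalIntegral.integral_mono_on_of_le_Ioo ht.le hpi (hri'.mul_const _) fun u hu => ?_
    exact mul_le_mul_of_nonneg_left (hp h0 ⟨hu.1.le, hu.2.le⟩ hu.1.le)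
      (hrpos _ (sub_pos.2 hu.2)).le

theorem mul_le_integral_of_antitoneOn {r : ℝ → ℝ} {t : ℝ} (ht : 0 < t)
    (hr : IntegrableOn r (Set.Ioc 0 t)) (hranti : AntitoneOn r (Set.Ioi 0)) :
    t * r t ≤ ∫ u in (0 : ℝ)..t, r u := by
  have h := intervalIntegral.integral_mono_on_of_le_Ioo ht.le
    (intervalIntegrable_const (c := r t) (μ := volume))
    ((intervalIntegrable_iff_integrableOn_Ioc_of_le ht.le).2 hr)
    fun u hu => hranti hu.1 ht hu.2.le
  simpa using h

theorem strictMonoOn_integral_of_pos {g V : ℝ → ℝ} (hg : ContinuousOn g (Set.Ici 1))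
    (hgpos : ∀ x ∈ Set.Ici (1 : ℝ), 0 < g x)
    (hV : ∀ x ∈ Set.Ici (1 : ℝ), V x = ∫ u in (1 : ℝ)..x, g u) :
    StrictMonoOn V (Set.Ici 1) := by
  have hgi : ∀ a ∈ Set.Ici (1 : ℝ), ∀ b ∈ Set.Ici (1 : ℝ), IntervalIntegrable g volume a b := by
    intro a ha b hb
    refine (hg.mono fun x hx => ?_).intervalIntegrable
    exact (le_min ha hb).trans hx.1
  intro a ha b hb hab
  have h1 : (1 : ℝ) ∈ Set.Ici (1 : ℝ) := Set.self_mem_Ici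
  rw [← sub_pos, hV a ha, hV b hb,
    intervalIntegral.integral_interval_sub_left (hgi 1 h1 b hb) (hgi 1 h1 a ha)]
  exact intervalIntegral.intervalIntegral_pos_of_pos_on (hgi a ha b hb)
    (fun x hx => hgpos x (le_trans (show (1 : ℝ) ≤ a from ha) hx.1.le)) hab

end

open Filter MeasureTheory Real in
theorem stmt19
    (μ γ α : ℝ) (hμ : 0 < μ) (hγ : γ ∈ Set.Ioc (0:ℝ) 1) (hα : α ∈ Set.Ioc (0:ℝ) 1)
    (L l : ℝ → ℝ)
    (hLpos : ∀ x ∈ Set.Ici (1:ℝ), 0 < L x)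
    (hLcont : ContinuousOn L (Set.Ici 1))
    (hLsv : ∀ c > (0:ℝ), Filter.Tendsto (fun t => L (c * t) / L t) Filter.atTop (nhds 1))
    (hlsv : ∀ c > (0:ℝ), Filter.Tendsto (fun t => l (c * t) / l t) Filter.atTop (nhds 1))
    (V W : ℝ → ℝ)
    (hV : ∀ x ∈ Set.Ici (1:ℝ), V x = ∫ u in (1:ℝ)..x, u ^ (γ - 1) / L u)
    (hVtop : Filter.Tendsto V Filter.atTop Filter.atTop)
    (hWmem : ∀ y ∈ Set.Ici (0:ℝ), W y ∈ Set.Ici (1:ℝ))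
    (hVW : ∀ y ∈ Set.Ici (0:ℝ), V (W y) = y)
    (hWV : ∀ x ∈ Set.Ici (1:ℝ), W (V x) = x)
    (Ψ : ℝ → ℝ)
    (hΨ : ∀ x ∈ Set.Ici (1:ℝ), Ψ x = x ^ α / l x)
    (hΨmono : MonotoneOn Ψ (Set.Ici 1))
    (hΨtop : Filter.Tendsto Ψ Filter.atTop Filter.atTop)
    (q : ℝ → ℝ → ℝ)
    (hq : ∀ t ∈ Set.Ici (0:ℝ), ∀ s ∈ Set.Ico (0:ℝ) 1,
      q t s = 1 / Ψ (W (μ * t + V (1 / (1 - s)))))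
    (θ : ℝ) (hθpos : 0 < θ)
    (r : ℝ → ℝ)
    (hrpos : ∀ t > (0:ℝ), 0 < r t)
    (hranti : AntitoneOn r (Set.Ioi 0))
    (hrint : ∀ t > (0:ℝ), MeasureTheory.IntegrableOn r (Set.Ioc 0 t))
    (hrrv : ∀ c > (0:ℝ), Filter.Tendsto (fun t => r (c * t) / r t) Filter.atTop (nhds (c ^ (-θ))))
    (R Q : ℝ → ℝ)
    (hR : ∀ t, R t = ∫ u in (0:ℝ)..t, r u)
    (hQ : ∀ t, Q t = ∫ u in (0:ℝ)..t, q u 0)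
    (I : ℝ → ℝ → ℝ) (hI : ∀ t s, I t s = ∫ u in (0:ℝ)..t, r (t - u) * q u s)
    (Φ : ℝ → ℝ → ℝ) (hΦ : ∀ t s, Φ t s = Real.exp (-(I t s)))
    (hθ : θ < 1) (hαγ : α / γ < 1)
    (hlim : Filter.Tendsto (fun t => t * r t * q t 0) Filter.atTop Filter.atTop)
    (Ψinv : ℝ → ℝ)
    (hΨinvmono : MonotoneOn Ψinv (Set.Ici (Ψ 1)))
    (hΨinvΨ : ∀ x ∈ Set.Ici (1:ℝ), Ψinv (Ψ x) = x)
    (hΨΨinv : ∀ y ∈ Set.Ici (Ψ 1), Ψ (Ψinv y) = y)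
    (lam : ℝ) (hlam : 0 < lam) :
    Filter.Tendsto (fun t => I t (Real.exp (-(lam / Ψinv (R t)))))
      Filter.atTop (nhds (lam ^ α))
    ∧ Filter.Tendsto (fun t => Φ t (Real.exp (-(lam / Ψinv (R t)))))
        Filter.atTop (nhds (Real.exp (-(lam ^ α)))) := by
  have hcts : ContinuousOn (fun u : ℝ => u ^ (γ - 1) / L u) (Set.Ici 1) := by
    refine ContinuousOn.div ?_ hLcont fun x hx => (hLpos x hx).ne'
    exact continuousOn_id.rpow_const fun x hx => Or.inl (zero_lt_one.trans_le hx).ne'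
  have hVmono : StrictMonoOn V (Set.Ici 1) := strictMonoOn_integral_of_pos hcts
    (fun x hx => div_pos (rpow_pos_of_pos (zero_lt_one.trans_le hx) _) (hLpos x hx)) hV
  have hV1 : V 1 = 0 := by rw [hV 1 Set.self_mem_Ici, intervalIntegral.integral_same]
  have hVnonneg : ∀ x ∈ Set.Ici (1 : ℝ), 0 ≤ V x := fun x hx =>
    hV1 ▸ hVmono.monotoneOn Set.self_mem_Ici hx hx
  have hWmono : MonotoneOn W (Set.Ici 0) := fun a ha b hb hab =>
    (hVmono.le_iff_le (hWmem a ha) (hWmem b hb)).1 (by rwa [hVW a ha, hVW b hb])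
  have hWtop : Tendsto W atTop atTop := by
    refine tendsto_atTop.2 fun b => ?_
    have hb : max b 1 ∈ Set.Ici (1 : ℝ) := le_max_right b 1
    filter_upwards [eventually_ge_atTop (V (max b 1))] with y hy
    have h0 := hVnonneg _ hb
    have h := hWmono h0 (h0.trans hy) hy
    rw [hWV _ hb] at h
    exact (le_max_left b 1).trans h
  have hΨrv := tendsto_rpow_div_slowlyVarying hlsv hΨ
  have hΨcomp {a b : ℝ → ℝ} {c : ℝ} (hc : 0 < c) (hb : Tendsto b atTop atTop)
      (hab : Tendsto (fun t => a t / b t) atTop (nhds c)) :=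
    tendsto_div_of_regularlyVarying hΨmono hΨtop hΨrv hc hb hab
  have hVgrow {c : ℝ} (hc : 1 < c) :=
    exists_mul_integral_le_integral_dilate hγ.1 hLpos hLcont hLsv hV hVtop hc
  have hw : Tendsto (fun t => W (μ * t)) atTop atTop :=
    hWtop.comp (tendsto_id.const_mul_atTop hμ)
  have hq0 : ∀ t ≥ (0 : ℝ), q t 0 = 1 / Ψ (W (μ * t)) := fun t ht => by
    rw [hq t ht 0 ⟨le_rfl, zero_lt_one⟩]
    norm_num [hV1]
  -- `R t` dominates `Ψ (W (μ * t))`.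
  have hRw : ∀ M : ℝ, ∀ᶠ t in atTop, M * Ψ (W (μ * t)) < R t := by
    intro M
    filter_upwards [eventually_gt_atTop 0, hlim.eventually_gt_atTop M,
      hw.eventually (hΨtop.eventually_gt_atTop 0)] with t ht h1 h2
    rw [hq0 t ht.le, mul_one_div, lt_div_iff₀ h2] at h1
    rw [hR t]
    exact h1.trans_le (mul_le_integral_of_antitoneOn ht (hrint t ht) hranti)
  have hRtop : Tendsto R atTop atTop := by
    refine tendsto_atTop_mono' _ ?_ (hΨtop.comp hw)
    filter_upwards [hRw 1] with t ht
    simpa using ht.le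
  set x : ℝ → ℝ := fun t => Ψinv (R t) with hx
  have hxtop : Tendsto x atTop atTop := by
    refine tendsto_atTop.2 fun b => ?_
    have hb : max b 1 ∈ Set.Ici (1 : ℝ) := le_max_right b 1
    filter_upwards [hRtop.eventually_ge_atTop (Ψ (max b 1))] with t ht
    have h0 : Ψ 1 ≤ Ψ (max b 1) := hΨmono Set.self_mem_Ici hb hb
    have h := hΨinvmono h0 (h0.trans ht) ht
    rw [hΨinvΨ _ hb] at h
    exact (le_max_left b 1).trans h
  have hΨx : ∀ᶠ t in atTop, Ψ (x t) = R t := by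
    filter_upwards [hRtop.eventually_ge_atTop (Ψ 1)] with t ht using hΨΨinv _ ht
  have hxw : ∀ C > (0 : ℝ), ∀ᶠ t in atTop, C * W (μ * t) ≤ x t := by
    intro C hC
    filter_upwards [hRw (C ^ α + 1), hΨx, hxtop.eventually_ge_atTop 1,
      hw.eventually (hΨtop.eventually_gt_atTop 0),
      (hw.const_mul_atTop hC).eventually_ge_atTop 1,
      ((hΨrv C hC).comp hw).eventually (gt_mem_nhds (lt_add_one (C ^ α)))] with t h1 h2 h3 h4 h5 h6
    by_contra! hlt
    have h7 := hΨmono h3 h5 hlt.le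
    have h8 := (div_lt_iff₀ h4).1 h6
    linarith
  set y : ℝ → ℝ := fun t => 1 / (1 - exp (-(lam / x t))) with hy
  have hyx : Tendsto (fun t => y t / x t) atTop (nhds lam⁻¹) := by
    have h0 : Tendsto (fun t => lam / x t) atTop (nhdsWithin 0 (Set.Ioi 0)) := by
      refine tendsto_nhdsWithin_iff.2 ⟨hxtop.const_div_atTop lam, ?_⟩
      filter_upwards [hxtop.eventually_gt_atTop 0] with t ht using div_pos hlam ht
    have h1 := (tendsto_div_one_sub_exp_neg.comp h0).const_mul lam⁻¹
    rw [mul_one] at h1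
    refine h1.congr fun t => ?_
    simp only [hy, Function.comp]
    rw [← mul_div_assoc, ← mul_div_assoc, inv_mul_cancel₀ hlam.ne', div_right_comm]
  have hlam' : 0 < lam⁻¹ := inv_pos.2 hlam
  have hytop : Tendsto y atTop atTop := by
    refine (hyx.pos_mul_atTop hlam' hxtop).congr' ?_
    filter_upwards [hxtop.eventually_gt_atTop 0] with t ht
    field_simp
  have hyw : ∀ C > (0 : ℝ), ∀ᶠ t in atTop, C * W (μ * t) ≤ y t := by
    intro C hC
    obtain ⟨d, hd0, hd⟩ := exists_between hlam'
    filter_upwards [hyx.eventually (lt_mem_nhds hd), hxw (C / d) (div_pos hC hd0),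
      hxtop.eventually_gt_atTop 0] with t h1 h2 h3
    calc C * W (μ * t) = d * (C / d * W (μ * t)) := by field_simp
      _ ≤ d * x t := by gcongr
      _ ≤ y t := ((lt_div_iff₀ h3).1 h1).le
  have hVy : ∀ M : ℝ, ∀ᶠ t in atTop, M * (μ * t) ≤ V (y t) := by
    intro M
    obtain ⟨k, hk, hkV⟩ := hVgrow one_lt_two
    obtain ⟨C, hC, hCV⟩ := exists_forall_mul_le_dilate hVtop two_pos hk hkV M
    filter_upwards [hw.eventually hCV, hyw C hC, hytop.eventually_ge_atTop 1,
      (hw.const_mul_atTop hC).eventually_ge_atTop 1, eventually_ge_atTop 0] with t h1 h2 h3 h4 h5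
    rw [hVW _ (mul_nonneg hμ.le h5)] at h1
    exact h1.trans (hVmono.monotoneOn h4 h3 h2)
  set z : ℝ → ℝ := fun t => W (μ * t + V (y t)) with hz
  have hyz : ∀ᶠ t in atTop, y t ≤ z t := by
    filter_upwards [hytop.eventually_ge_atTop 1, eventually_ge_atTop 0] with t h1 h2
    have h3 := hVnonneg _ h1
    have h4 := mul_nonneg hμ.le h2
    have h := hWmono h3 (add_nonneg h4 h3 : 0 ≤ μ * t + V (y t)) (by linarith)
    rwa [hWV _ h1] at h
  have hzy : Tendsto (fun t => z t / y t) atTop (nhds 1) := by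
    rw [tendsto_order]
    constructor
    · intro m hm
      filter_upwards [hyz, hytop.eventually_gt_atTop 0] with t h1 h2
      exact hm.trans_le ((one_le_div h2).2 h1)
    · intro m hm
      obtain ⟨c, hc1, hcm⟩ := exists_between hm
      obtain ⟨k, hk, hkV⟩ := hVgrow hc1
      filter_upwards [hytop.eventually hkV, hVy (k - 1)⁻¹, hytop.eventually_ge_atTop 1,
        eventually_ge_atTop 0] with t h1 h2 h3 h4
      have h5 : 0 ≤ μ * t + V (y t) := add_nonneg (mul_nonneg hμ.le h4) (hVnonneg _ h3)
      have h6 : μ * t ≤ (k - 1) * V (y t) := (inv_mul_le_iff₀ (sub_pos.2 hk)).1 h2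
      have h7 : 1 ≤ c * y t := by nlinarith
      have h8 : z t ≤ c * y t := by
        refine (hVmono.le_iff_le (hWmem _ h5) h7).1 ?_
        rw [hVW _ h5]
        linarith
      have h9 : 0 < y t := by linarith
      exact ((div_le_iff₀ h9).2 h8).trans_lt hcm
  have hΨy : Tendsto (fun t => R t * (1 / Ψ (y t))) atTop (nhds (lam ^ α)) := by
    have h := (hΨcomp hlam' hxtop hyx).inv₀ (rpow_pos_of_pos hlam' α).ne'
    rw [inv_rpow hlam.le, inv_inv] at h
    refine h.congr' ?_
    filter_upwards [hΨx] with t ht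
    rw [inv_div, ht, mul_one_div]
  have hΨz : Tendsto (fun t => R t * (1 / Ψ (z t))) atTop (nhds (lam ^ α)) := by
    have h := hΨy.mul ((hΨcomp one_pos hytop hzy).inv₀ (by simp))
    rw [one_rpow, inv_one, mul_one] at h
    refine h.congr' ?_
    filter_upwards [hytop.eventually (hΨtop.eventually_gt_atTop 0)] with t ht
    rw [inv_div, mul_assoc, one_div_mul_eq_div, div_div, mul_comm (Ψ (z t)), ← div_div,
      div_self ht.ne']
  have hmain : ∀ᶠ t in atTop, I t (exp (-(lam / x t))) ∈
      Set.Icc (R t * (1 / Ψ (z t))) (R t * (1 / Ψ (y t))) := by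
    filter_upwards [eventually_gt_atTop 0, hytop.eventually_ge_atTop 1,
      hytop.eventually (hΨtop.eventually_gt_atTop 0), hxtop.eventually_gt_atTop 0]
      with t ht hy1 hΨpos hx0
    have hs : exp (-(lam / x t)) ∈ Set.Ico (0 : ℝ) 1 :=
      ⟨(exp_pos _).le, exp_lt_one_iff.2 (neg_lt_zero.2 (div_pos hlam hx0))⟩
    have hqu : ∀ u ∈ Set.Ici (0 : ℝ), q u (exp (-(lam / x t))) = 1 / Ψ (W (μ * u + V (y t))) :=
      fun u hu => hq u hu _ hs
    have harg : ∀ u ∈ Set.Ici (0 : ℝ), 0 ≤ μ * u + V (y t) := fun u hu =>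
      add_nonneg (mul_nonneg hμ.le hu) (hVnonneg _ hy1)
    have hanti : AntitoneOn (fun u => q u (exp (-(lam / x t)))) (Set.Icc 0 t) := by
      intro u hu v hv huv
      simp only [hqu u hu.1, hqu v hv.1]
      have h1 : W (V (y t)) ≤ W (μ * u + V (y t)) := hWmono (hVnonneg _ hy1) (harg u hu.1)
        (le_add_of_nonneg_left (mul_nonneg hμ.le hu.1))
      rw [hWV _ hy1] at h1
      refine one_div_le_one_div_of_le
        (hΨpos.trans_le (hΨmono hy1 (hWmem _ (harg u hu.1)) h1)) ?_
      refine hΨmono (hWmem _ (harg u hu.1)) (hWmem _ (harg v hv.1))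
        (hWmono (harg u hu.1) (harg v hv.1) ?_)
      gcongr
    have h := integral_comp_sub_mul_mem_Icc ht (hrint t ht) hrpos hanti
    rw [← hR, ← hI, hqu t ht.le, hqu 0 Set.self_mem_Ici, mul_zero, zero_add, hWV _ hy1] at h
    exact h
  have hIlim : Tendsto (fun t => I t (exp (-(lam / x t)))) atTop (nhds (lam ^ α)) :=
    tendsto_of_tendsto_of_tendsto_of_le_of_le' hΨz hΨy (hmain.mono fun _ h => h.1)
      (hmain.mono fun _ h => h.2)
  refine ⟨hIlim, ?_⟩
  simp only [hΦ]
  exact (continuous_exp.tendsto _).comp hIlim.neg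
end
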